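/- arXiv:1501.05579 — 2 statements merged into one kernel-verified Lean document; each statement's English description precedes it below -/
import Mathlib

section
/- Let G = ⟨H, t | t a t⁻¹ = φ(a) for a ∈ A⟩ be an HNN extension with [H : A] ≥ 2 and [H : B] ≥ 2, and let η : Σ → G be a finite symmetric generating set of G. Then there exist constants C > 0 and 0 < ρ < 1 such that for every n ∈ ℕ the number of cyclically reduced words of length n over Σ representing elliptic elements of G is at most C·ρⁿ times the number of all reduced words of length n over Σ. -/
universe u

open Monoid

/-- The number of words of length `n` over `α` lying in `L`. -/
noncomputable def wordCount {α : Type*} (L : Set (List α)) (n : ℕ) : ℕ :=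
  Nat.card {w : List α // w ∈ L ∧ w.length = n}

/-- A set of words over a finite alphabet is strongly negligible: the number of its words of
length `n` is at most `C·ρⁿ·|Σ|ⁿ` for some constants `C > 0` and `0 < ρ < 1`. -/
def StronglyNegligible {α : Type*} [Fintype α] (L : Set (List α)) : Prop :=
  ∃ C ρ : ℝ, 0 < C ∧ 0 < ρ ∧ ρ < 1 ∧ ∀ n : ℕ,
    (wordCount L n : ℝ) ≤ C * ρ ^ n * (Fintype.card α : ℝ) ^ n

/-- A set of words is strongly generic if its complement is strongly negligible. -/
def StronglyGeneric {α : Type*} [Fintype α] (L : Set (List α)) : Prop :=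
  StronglyNegligible Lᶜ

/-- `η : α → G` together with the involution `inv` is a symmetric generating set:
`inv` is a fixed-point-free involution, `η (inv a) = (η a)⁻¹`, and the image of `η`
generates `G` as a group. -/
def IsSymmetricGen {α G : Type*} [Group G] (η : α → G) (inv : α → α) : Prop :=
  (∀ a, inv (inv a) = a) ∧ (∀ a, inv a ≠ a) ∧ (∀ a, η (inv a) = (η a)⁻¹) ∧
    Subgroup.closure (Set.range η) = ⊤

/-- The element of `G` represented by a word over `α`. -/
def evalWord {α G : Type*} [Monoid G] (η : α → G) (w : List α) : G :=
  (w.map η).prod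

/-- An element of `G` is elliptic with respect to the set `S` if it is conjugate in `G`
to an element of `S`. -/
def IsElliptic {G : Type*} [Group G] (S : Set G) (x : G) : Prop :=
  ∃ h ∈ S, IsConj h x

/-- A word is reduced (w.r.t. the involution `inv`) if no two consecutive letters are of
the form `a`, `inv a`. -/
def Reduced {α : Type*} (inv : α → α) (w : List α) : Prop :=
  List.Chain' (fun a b => b ≠ inv a) w

/-- A word is cyclically reduced if its concatenation with itself is reduced. -/
def CyclicallyReduced {α : Type*} (inv : α → α) (w : List α) : Prop :=
  Reduced inv (w ++ w)


section Contraction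

variable {E : Type*} [NormedAddCommGroup E] [InnerProductSpace ℝ E]

/-- Variance identity, in inequality-friendly form. -/
theorem variance_identity {ι : Type*} (s : Finset ι) (v : ι → E) :
    ∑ i ∈ s, ∑ j ∈ s, ‖v i - v j‖ ^ 2 =
      2 * ((s.card : ℝ) * ∑ i ∈ s, ‖v i‖ ^ 2 - ‖∑ i ∈ s, v i‖ ^ 2) := by
  have h1 : ∀ i j, ‖v i - v j‖ ^ 2 = ‖v i‖ ^ 2 - 2 * inner ℝ (v i) (v j) + ‖v j‖ ^ 2 :=
    fun i j => norm_sub_sq_real _ _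
  have h2 : ‖∑ i ∈ s, v i‖ ^ 2 = ∑ i ∈ s, ∑ j ∈ s, inner ℝ (v i) (v j) := by
    rw [← real_inner_self_eq_norm_sq, sum_inner]
    exact Finset.sum_congr rfl fun i _ => inner_sum _ _ _
  simp only [h1, Finset.sum_add_distrib, Finset.sum_sub_distrib, ← Finset.mul_sum, h2,
    Finset.sum_const, nsmul_eq_mul]
  ring

variable {α : Type*} [Fintype α] [DecidableEq α]

/-- The non-backtracking operator. -/
def nbOp (inv : α → α) (p : α → E →ₗᵢ[ℝ] E) (F : α → E) (a : α) : E :=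
  ∑ b ∈ Finset.univ.filter (fun b => b ≠ inv a), p b (F b)

/-- squared norm of a family -/
def sqn (F : α → E) : ℝ := ∑ a, ‖F a‖ ^ 2

theorem card_filter_ne (c : α) :
    ((Finset.univ.filter (fun b : α => b ≠ c)).card : ℝ) = (Fintype.card α : ℝ) - 1 := by
  have : Finset.univ.filter (fun b : α => b ≠ c) = Finset.univ.erase c := by ext; simp
  rw [this, Finset.card_erase_of_mem (Finset.mem_univ _), Nat.cast_sub]
  · simp
  · exact Finset.card_pos.2 ⟨c, Finset.mem_univ _⟩

theorem nbOp_identity (inv : α → α) (hinv : ∀ a, inv (inv a) = a) (p : α → E →ₗᵢ[ℝ] E)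
    (F : α → E) :
    ∑ a, ∑ i ∈ Finset.univ.filter (fun b => b ≠ inv a),
      ∑ j ∈ Finset.univ.filter (fun b => b ≠ inv a), ‖p i (F i) - p j (F j)‖ ^ 2 =
      2 * (((Fintype.card α : ℝ) - 1) ^ 2 * sqn F - sqn (nbOp inv p F)) := by
  have h : ∀ a, ∑ i ∈ Finset.univ.filter (fun b => b ≠ inv a),
      ∑ j ∈ Finset.univ.filter (fun b => b ≠ inv a), ‖p i (F i) - p j (F j)‖ ^ 2 =
      2 * (((Fintype.card α : ℝ) - 1) *
        ∑ i ∈ Finset.univ.filter (fun b => b ≠ inv a), ‖F i‖ ^ 2 - ‖nbOp inv p F a‖ ^ 2) := by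
    intro a
    rw [variance_identity, card_filter_ne]
    simp [nbOp]
  have h2 : ∑ a, ∑ i ∈ Finset.univ.filter (fun b => b ≠ inv a), ‖F i‖ ^ 2 =
      ((Fintype.card α : ℝ) - 1) * sqn F := by
    simp only [Finset.sum_filter]
    rw [Finset.sum_comm, sqn, Finset.mul_sum]
    refine Finset.sum_congr rfl fun b _ => ?_
    rw [← Finset.sum_filter, Finset.sum_const, nsmul_eq_mul, ← card_filter_ne (inv b)]
    congr 3
    ext a
    simp only [Finset.mem_filter, Finset.mem_univ, true_and]
    constructor
    · rintro h rfl; exact h (hinv _).symm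
    · rintro h rfl; exact h (hinv _).symm
  simp only [h, ← Finset.mul_sum, Finset.sum_sub_distrib, h2, sqn]
  ring

theorem nbOp_le (inv : α → α) (hinv : ∀ a, inv (inv a) = a) (p : α → E →ₗᵢ[ℝ] E)
    (F : α → E) : sqn (nbOp inv p F) ≤ ((Fintype.card α : ℝ) - 1) ^ 2 * sqn F := by
  have := nbOp_identity inv hinv p F
  have h0 : 0 ≤ ∑ a, ∑ i ∈ Finset.univ.filter (fun b => b ≠ inv a),
      ∑ j ∈ Finset.univ.filter (fun b => b ≠ inv a), ‖p i (F i) - p j (F j)‖ ^ 2 := by positivity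
  linarith

theorem exists_not_inv (inv : α → α) (hinv : ∀ a, inv (inv a) = a) (hcard : 3 ≤ Fintype.card α)
    (b b' : α) : ∃ a, b ≠ inv a ∧ b' ≠ inv a := by
  have : ∃ c, c ∉ ({inv b, inv b'} : Finset α) := by
    by_contra! h
    have h1 : (Finset.univ : Finset α) ⊆ {inv b, inv b'} := fun x _ => h x
    have := Finset.card_le_card h1
    have := Finset.card_le_two (a := inv b) (b := inv b')
    simp only [Finset.card_univ] at *
    omega
  obtain ⟨c, hc⟩ := this
  simp only [Finset.mem_insert, Finset.mem_singleton, not_or] at hc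
  refine ⟨c, ?_, ?_⟩
  · rintro rfl; exact hc.1 (hinv _).symm
  · rintro rfl; exact hc.2 (hinv _).symm

theorem nbOp_diff (inv : α → α) (hinv : ∀ a, inv (inv a) = a) (hcard : 3 ≤ Fintype.card α)
    (p : α → E →ₗᵢ[ℝ] E) (F : α → E) (b b' : α) :
    ‖p b (F b) - p b' (F b')‖ ^ 2 ≤
      2 * (((Fintype.card α : ℝ) - 1) ^ 2 * sqn F - sqn (nbOp inv p F)) := by
  rw [← nbOp_identity inv hinv]
  obtain ⟨a, h1, h2⟩ := exists_not_inv inv hinv hcard b b'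
  calc ‖p b (F b) - p b' (F b')‖ ^ 2
      ≤ ∑ j ∈ Finset.univ.filter (fun b => b ≠ inv a), ‖p b (F b) - p j (F j)‖ ^ 2 :=
        Finset.single_le_sum (f := fun j => ‖p b (F b) - p j (F j)‖ ^ 2)
          (fun _ _ => by positivity) (by simpa using h2)
    _ ≤ ∑ i ∈ Finset.univ.filter (fun b => b ≠ inv a),
          ∑ j ∈ Finset.univ.filter (fun b => b ≠ inv a), ‖p i (F i) - p j (F j)‖ ^ 2 :=
        Finset.single_le_sum
          (f := fun i => ∑ j ∈ Finset.univ.filter (fun b => b ≠ inv a),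
            ‖p i (F i) - p j (F j)‖ ^ 2)
          (fun _ _ => by positivity) (by simpa using h1)
    _ ≤ _ := Finset.single_le_sum
          (f := fun a => ∑ i ∈ Finset.univ.filter (fun b => b ≠ inv a),
            ∑ j ∈ Finset.univ.filter (fun b => b ≠ inv a), ‖p i (F i) - p j (F j)‖ ^ 2)
          (fun _ _ => by positivity) (Finset.mem_univ a)

/-- Uniform contraction of the square of the non-backtracking operator on a cone. -/
theorem nbOp_sq_contract (inv : α → α) (hinv : ∀ a, inv (inv a) = a)
    (hcard : 3 ≤ Fintype.card α) (p : α → E →ₗᵢ[ℝ] E)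
    (hp : ∀ a x, p a (p (inv a) x) = x)
    (K : Set E) (hKp : ∀ a, ∀ x ∈ K, p a x ∈ K)
    (hKi : ∀ x ∈ K, ∀ y ∈ K, 0 ≤ inner ℝ x y)
    (δ : ℝ) (hδ : 0 < δ) (hgap : ∀ x : E, (∀ a, ‖p a x - x‖ ≤ δ * ‖x‖) → x = 0) :
    ∃ θ : ℝ, 0 < θ ∧ θ < 1 ∧ ∀ F : α → E, (∀ a, F a ∈ K) →
      sqn (nbOp inv p (nbOp inv p F)) ≤ θ * ((Fintype.card α : ℝ) - 1) ^ 4 * sqn F := by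
  set q : ℝ := (Fintype.card α : ℝ) - 1 with hq
  have hq2 : 2 ≤ q := by
    have : (3 : ℝ) ≤ Fintype.card α := by exact_mod_cast hcard
    linarith
  -- the constant
  obtain ⟨τ, hτ0, hτ1, hτ2⟩ : ∃ τ : ℝ, 0 < τ ∧ τ < 1 ∧
      (q + 1) * (6 * τ / δ + τ) ^ 2 < 1 := by
    have hc : Filter.Tendsto (fun τ : ℝ => (q + 1) * (6 * τ / δ + τ) ^ 2) (nhdsWithin 0 (Set.Ioi 0))
        (nhds ((q + 1) * (6 * 0 / δ + 0) ^ 2)) := by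
      apply Filter.Tendsto.mono_left _ nhdsWithin_le_nhds
      apply Continuous.tendsto
      fun_prop
    have h1 := hc.eventually_lt_const (u := 1) (by simp)
    have h2 : ∀ᶠ τ : ℝ in nhdsWithin 0 (Set.Ioi 0), τ ∈ Set.Ioo (0 : ℝ) 1 :=
      Ioo_mem_nhdsGT one_pos
    obtain ⟨τ, h3, h4⟩ := (h1.and h2).exists
    exact ⟨τ, h4.1, h4.2, h3⟩
  have hτq : τ ^ 2 / 2 < q ^ 4 := by
    have : (1 : ℝ) ≤ q ^ 4 := one_le_pow₀ (by linarith)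
    nlinarith
  refine ⟨1 - (τ ^ 2 / 2) / q ^ 4, ?_, ?_, ?_⟩
  · rw [sub_pos, div_lt_one (by positivity)]; exact hτq
  · have : 0 < (τ ^ 2 / 2) / q ^ 4 := by positivity
    linarith
  intro F hF
  by_contra! hcon
  have e1 : (1 - (τ ^ 2 / 2) / q ^ 4) * q ^ 4 * sqn F = q ^ 4 * sqn F - τ ^ 2 / 2 * sqn F := by
    field_simp
  rw [e1] at hcon
  have hS0 : 0 ≤ sqn F := by unfold sqn; positivity
  set R := Real.sqrt (sqn F) with hR
  have hRR : R ^ 2 = sqn F := Real.sq_sqrt hS0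
  have hR0 : 0 ≤ R := Real.sqrt_nonneg _
  have hN1 := nbOp_le inv hinv p F
  have hN2 := nbOp_le inv hinv p (nbOp inv p F)
  rw [← hq] at hN1 hN2
  -- first differences
  have d1 : ∀ b b', ‖p b (F b) - p b' (F b')‖ ≤ τ * R := by
    intro b b'
    have := nbOp_diff inv hinv hcard p F b b'
    rw [← hq] at this
    refine abs_le_of_sq_le_sq' ?_ (by positivity) |>.2
    rw [mul_pow, hRR]
    have h5 : q ^ 2 * (q ^ 2 * sqn F - sqn (nbOp inv p F)) ≤ τ ^ 2 / 2 * sqn F := by nlinarith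
    have h6 : 0 ≤ q ^ 2 * sqn F - sqn (nbOp inv p F) := by linarith
    have h7 : 1 ≤ q ^ 2 := by nlinarith
    have h8 := le_mul_of_one_le_left h6 h7
    linarith
  have d2 : ∀ b b', ‖p b (nbOp inv p F b) - p b' (nbOp inv p F b')‖ ≤ τ * R := by
    intro b b'
    have := nbOp_diff inv hinv hcard p (nbOp inv p F) b b'
    rw [← hq] at this
    refine abs_le_of_sq_le_sq' ?_ (by positivity) |>.2
    rw [mul_pow, hRR]
    nlinarith [sq_nonneg q]
  have : Nonempty α := Fintype.card_pos_iff.1 (by omega)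
  obtain ⟨b0⟩ := this
  set Ψ := p b0 (F b0) with hΨ
  have hN : ∀ a, ‖nbOp inv p F a - q • Ψ‖ ≤ q * (τ * R) := by
    intro a
    have : nbOp inv p F a - q • Ψ =
        ∑ b ∈ Finset.univ.filter (fun b => b ≠ inv a), (p b (F b) - Ψ) := by
      rw [Finset.sum_sub_distrib, Finset.sum_const, hq, ← card_filter_ne (inv a)]
      simp [nbOp, ← Nat.cast_smul_eq_nsmul ℝ]
    rw [this]
    refine (norm_sum_le _ _).trans ?_
    refine (Finset.sum_le_card_nsmul _ _ _ fun b _ => d1 b b0).trans ?_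
    rw [nsmul_eq_mul, card_filter_ne]
  have d3 : ∀ b b', ‖p b Ψ - p b' Ψ‖ ≤ 3 * τ * R := by
    intro b b'
    have h1 : q • (p b Ψ - p b' Ψ) = (p b (nbOp inv p F b) - p b' (nbOp inv p F b'))
        - p b (nbOp inv p F b - q • Ψ) + p b' (nbOp inv p F b' - q • Ψ) := by
      simp only [map_sub, map_smul, smul_sub]; abel
    have h2 : q * ‖p b Ψ - p b' Ψ‖ ≤ τ * R + q * (τ * R) + q * (τ * R) := by
      calc q * ‖p b Ψ - p b' Ψ‖ = ‖q • (p b Ψ - p b' Ψ)‖ := by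
            rw [norm_smul, Real.norm_of_nonneg (by linarith)]
        _ ≤ ‖p b (nbOp inv p F b) - p b' (nbOp inv p F b')‖
            + ‖p b (nbOp inv p F b - q • Ψ)‖ + ‖p b' (nbOp inv p F b' - q • Ψ)‖ := by
            rw [h1]
            exact (norm_add_le _ _).trans (add_le_add_left (norm_sub_le _ _) _)
        _ ≤ _ := by
            rw [LinearIsometry.norm_map, LinearIsometry.norm_map]
            exact add_le_add (add_le_add (d2 _ _) (hN _)) (hN _)
    have h3 : 0 ≤ τ * R := by positivity
    nlinarith
  have hΨK : Ψ ∈ K := hKp _ _ (hF _)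
  set Φ := Ψ + p b0 Ψ with hΦ
  have hΦ1 : ‖Ψ‖ ≤ ‖Φ‖ := by
    refine abs_le_of_sq_le_sq' ?_ (by positivity) |>.2
    rw [hΦ, norm_add_sq_real]
    have := hKi Ψ hΨK _ (hKp b0 _ hΨK)
    nlinarith [sq_nonneg ‖p b0 Ψ‖]
  have hΦ2 : ∀ a, ‖p a Φ - Φ‖ ≤ 6 * τ * R := by
    intro a
    have h1 : p a Φ - Φ = (p a Ψ - p b0 Ψ) + p a (p b0 Ψ - p (inv a) Ψ) := by
      rw [hΦ, map_sub, hp, map_add]; abel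
    rw [h1]
    refine (norm_add_le _ _).trans ?_
    rw [LinearIsometry.norm_map]
    linarith [d3 a b0, d3 b0 (inv a)]
  have hΦ3 : δ * ‖Φ‖ ≤ 6 * τ * R := by
    by_contra! h
    have h0 := hgap Φ fun a => (hΦ2 a).trans h.le
    rw [h0, norm_zero] at h
    have : 0 ≤ 6 * τ * R := by positivity
    linarith
  have hΨ2 : ‖Ψ‖ ≤ 6 * τ / δ * R := by
    refine hΦ1.trans ?_
    rw [div_mul_eq_mul_div, le_div_iff₀ hδ]; linarith
  have hF2 : ∀ b, ‖F b‖ ≤ (6 * τ / δ + τ) * R := by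
    intro b
    have : ‖F b‖ ≤ ‖Ψ‖ + ‖p b (F b) - p b0 (F b0)‖ := by
      rw [← LinearIsometry.norm_map (p b) (F b)]
      have := norm_add_le Ψ (p b (F b) - p b0 (F b0))
      simpa [hΨ] using this
    linarith [d1 b b0]
  have hfin : R ^ 2 ≤ (q + 1) * (6 * τ / δ + τ) ^ 2 * R ^ 2 := by
    calc R ^ 2 = ∑ b, ‖F b‖ ^ 2 := hRR
      _ ≤ ∑ b : α, ((6 * τ / δ + τ) * R) ^ 2 :=
        Finset.sum_le_sum fun b _ => pow_le_pow_left₀ (norm_nonneg _) (hF2 b) 2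
      _ = _ := by
        rw [Finset.sum_const, nsmul_eq_mul, Finset.card_univ, hq]; ring
  have hR00 : R ^ 2 = 0 := by
    by_contra hne
    have : 0 < R ^ 2 := lt_of_le_of_ne (by positivity) (Ne.symm hne)
    nlinarith
  rw [hRR] at hR00
  have h9 : 0 ≤ sqn (nbOp inv p F) := by unfold sqn; positivity
  rw [hR00] at hcon hN1
  nlinarith

/-- Exponential decay for iterates. -/
theorem nbOp_iterate_decay (inv : α → α) (hinv : ∀ a, inv (inv a) = a)
    (hcard : 3 ≤ Fintype.card α) (p : α → E →ₗᵢ[ℝ] E)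
    (hp : ∀ a x, p a (p (inv a) x) = x)
    (K : Set E) (hKp : ∀ a, ∀ x ∈ K, p a x ∈ K) (hK0 : (0 : E) ∈ K)
    (hKa : ∀ x ∈ K, ∀ y ∈ K, x + y ∈ K)
    (hKi : ∀ x ∈ K, ∀ y ∈ K, 0 ≤ inner ℝ x y)
    (δ : ℝ) (hδ : 0 < δ) (hgap : ∀ x : E, (∀ a, ‖p a x - x‖ ≤ δ * ‖x‖) → x = 0) :
    ∃ σ : ℝ, 0 < σ ∧ σ < 1 ∧ ∀ F : α → E, (∀ a, F a ∈ K) → ∀ n : ℕ,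
      σ ^ 2 * sqn ((nbOp inv p)^[n] F) ≤ (σ ^ n * ((Fintype.card α : ℝ) - 1) ^ n) ^ 2 * sqn F := by
  obtain ⟨θ, hθ0, hθ1, hθ⟩ := nbOp_sq_contract inv hinv hcard p hp K hKp hKi δ hδ hgap
  set q : ℝ := (Fintype.card α : ℝ) - 1 with hq
  set σ := Real.sqrt (Real.sqrt θ) with hσ
  have hσ4 : σ ^ 4 = θ := by
    rw [show 4 = 2 * 2 by norm_num, pow_mul, Real.sq_sqrt (Real.sqrt_nonneg _),
      Real.sq_sqrt hθ0.le]
  have hσ0 : 0 < σ := Real.sqrt_pos.2 (Real.sqrt_pos.2 hθ0)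
  have hσ1 : σ < 1 := by
    by_contra! h
    have := one_le_pow₀ h (n := 4)
    linarith
  have hstep : ∀ F : α → E, (∀ a, F a ∈ K) → ∀ a, nbOp inv p F a ∈ K := by
    intro F hF a
    unfold nbOp
    refine Finset.sum_induction _ (· ∈ K) (fun x y hx hy => hKa x hx y hy) hK0 ?_
    intro b _
    exact hKp _ _ (hF b)
  refine ⟨σ, hσ0, hσ1, ?_⟩
  intro F hF n
  have hS0 : 0 ≤ sqn F := by unfold sqn; positivity
  induction n using Nat.strong_induction_on generalizing F with
  | _ n ih =>
    match n with
    | 0 =>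
      simp only [Function.iterate_zero, id, pow_zero]
      have : σ ^ 2 ≤ 1 := pow_le_one₀ hσ0.le hσ1.le
      nlinarith
    | 1 =>
      have := nbOp_le inv hinv p F
      rw [← hq] at this
      simp only [Function.iterate_one, pow_one]
      rw [mul_pow, mul_assoc]
      exact mul_le_mul_of_nonneg_left this (by positivity)
    | n + 2 =>
      have h1 := ih n (by omega) (nbOp inv p (nbOp inv p F)) (hstep _ (hstep _ hF))
        (by unfold sqn; positivity)
      rw [Function.iterate_add_apply]
      refine h1.trans ?_
      have h2 := hθ F hF
      rw [← hσ4] at h2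
      calc _ ≤ (σ ^ n * q ^ n) ^ 2 * (σ ^ 4 * q ^ 4 * sqn F) :=
            mul_le_mul_of_nonneg_left h2 (by positivity)
        _ = _ := by ring

end Contraction

section Rep

variable {G X : Type*} [Group G] [MulAction G X]

/-- The real Hilbert space of square-summable functions on `X`. -/
abbrev L2 (X : Type*) := lp (fun _ : X => ℝ) 2

theorem L2_summable (f : L2 X) : Summable fun x => f x ^ 2 := by
  have := (lp.memℓp f).summable (by simp)
  simpa using this

theorem L2_norm_sq (f : L2 X) : ‖f‖ ^ 2 = ∑' x, f x ^ 2 := by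
  have := lp.norm_rpow_eq_tsum (p := 2) (by simp) f
  simpa using this

theorem memL2 {f : X → ℝ} (hf : Summable fun x => f x ^ 2) : Memℓp f 2 := by
  apply memℓp_gen
  simpa using hf

/-- Left translation on square-summable functions. -/
noncomputable def ltrans (g : G) : L2 X →ₗᵢ[ℝ] L2 X where
  toFun f := ⟨fun x => f (g⁻¹ • x), memL2 (by
    exact (MulAction.toPerm (g⁻¹) : Equiv.Perm X).summable_iff.2 (L2_summable f))⟩
  map_add' f f' := by ext x; rfl
  map_smul' c f := by ext x; rfl
  norm_map' f := by
    have h : ∀ f' : L2 X, (∀ x, f' x = f (g⁻¹ • x)) → ‖f'‖ = ‖f‖ := by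
      intro f' hf'
      have : ‖f'‖ ^ 2 = ‖f‖ ^ 2 := by
        rw [L2_norm_sq, L2_norm_sq]
        simp only [hf']
        exact (MulAction.toPerm (g⁻¹) : Equiv.Perm X).tsum_eq (fun x => f x ^ 2)
      exact (sq_eq_sq₀ (norm_nonneg _) (norm_nonneg _)).1 this
    exact h _ fun x => rfl

@[simp] theorem ltrans_apply (g : G) (f : L2 X) (x : X) : ltrans g f x = f (g⁻¹ • x) := rfl

theorem ltrans_mul (g h : G) (f : L2 X) : ltrans (g * h) f = ltrans g (ltrans h f) := by
  ext x
  simp [mul_smul]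

theorem ltrans_one (f : L2 X) : ltrans (1 : G) f = f := by
  ext x
  simp

theorem ltrans_single [DecidableEq X] (g : G) (y : X) :
    ltrans g (lp.single 2 y (1 : ℝ) : L2 X) = lp.single 2 (g • y) (1 : ℝ) := by
  ext x
  simp only [ltrans_apply, lp.single_apply, Pi.single_apply, inv_smul_eq_iff]

open Classical in
/-- Restriction to a set. -/
noncomputable def restr (V : Set X) (f : L2 X) : L2 X :=
  ⟨fun x => if x ∈ V then f x else 0, memL2 (by
    refine Summable.of_nonneg_of_le (fun _ => by positivity) (fun x => ?_) (L2_summable f)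
    split_ifs
    · exact le_rfl
    · simp; positivity)⟩

open Classical in
theorem restr_apply (V : Set X) (f : L2 X) (x : X) :
    restr V f x = if x ∈ V then f x else 0 := rfl

theorem restr_sub (V : Set X) (f g : L2 X) : restr V (f - g) = restr V f - restr V g := by
  ext x
  simp only [restr_apply, lp.coeFn_sub, Pi.sub_apply]
  split_ifs <;> simp

theorem restr_le (V : Set X) (f : L2 X) : ‖restr V f‖ ≤ ‖f‖ := by
  refine abs_le_of_sq_le_sq' ?_ (by positivity) |>.2
  rw [L2_norm_sq, L2_norm_sq]
  refine (L2_summable _).tsum_le_tsum (fun x => ?_) (L2_summable _)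
  rw [restr_apply]
  split_ifs
  · exact le_rfl
  · simp; positivity

theorem restr_near (V : Set X) (f g : L2 X) : ‖restr V f‖ ≤ ‖restr V g‖ + ‖f - g‖ := by
  have h1 := restr_le V (f - g)
  rw [restr_sub] at h1
  have := norm_le_insert' (restr V f) (restr V g)
  linarith

open Classical in
theorem four_excl {p q r s : Prop} (v : ℝ) (hv : 0 ≤ v) (h1 : p → r → False)
    (h2 : p → q → False) (h3 : p → s → False) (h4 : q → r → False) (h5 : q → s → False)
    (h6 : r → s → False) :
    (if p then v else 0) + (if q then v else 0) + (if r then v else 0) + (if s then v else 0)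
      ≤ v := by
  by_cases hp : p
  · have hq : ¬ q := fun h => h2 hp h
    have hr : ¬ r := fun h => h1 hp h
    have hs : ¬ s := fun h => h3 hp h
    simp [hp, hq, hr, hs]
  · by_cases hq : q
    · have hr : ¬ r := fun h => h4 hq h
      have hs : ¬ s := fun h => h5 hq h
      simp [hp, hq, hr, hs]
    · by_cases hr : r
      · have hs : ¬ s := fun h => h6 hr h
        simp [hp, hq, hr, hs]
      · simp only [hp, hq, hr, if_false, add_zero, zero_add]
        split_ifs <;> linarith

theorem sq_near (P P' N : ℝ) (h0 : 0 ≤ P) (h0' : 0 ≤ P') (hN : 0 ≤ N)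
    (h : P ≤ P' + 1 / 10 * N) (h1 : P ≤ N) : P ^ 2 ≤ P' ^ 2 + 1 / 5 * N ^ 2 := by
  rcases le_total P P' with h2 | h2
  · nlinarith
  · have h3 : (P - P') * (P + P') ≤ (1 / 10 * N) * (2 * N) :=
      mul_le_mul (by linarith) (by linarith) (by linarith) (by linarith)
    nlinarith

/-- Paradoxical decomposition gives a spectral gap for the three elements. -/
theorem gap_three (a b t : G) (Vp Vm : Set X)
    (hcov : ∀ x, x ∈ Vm ∨ t • x ∈ Vp)
    (h1 : ∀ x, x ∈ Vp → x ∈ Vm → False) (h2 : ∀ x, x ∈ Vp → b • x ∈ Vp → False)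
    (h3 : ∀ x, x ∈ Vp → a • x ∈ Vm → False) (h4 : ∀ x, b • x ∈ Vp → x ∈ Vm → False)
    (h5 : ∀ x, b • x ∈ Vp → a • x ∈ Vm → False) (h6 : ∀ x, x ∈ Vm → a • x ∈ Vm → False)
    (f : L2 X) (ha : ‖ltrans a f - f‖ ≤ 1 / 10 * ‖f‖) (hb : ‖ltrans b f - f‖ ≤ 1 / 10 * ‖f‖)
    (ht : ‖ltrans t f - f‖ ≤ 1 / 10 * ‖f‖) : f = 0 := by
  classical
  have key : ∀ (g : G) (V : Set X),
      ‖restr V (ltrans g f)‖ ^ 2 = ∑' x, (if g • x ∈ V then f x ^ 2 else 0) := by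
    intro g V
    rw [L2_norm_sq, ← (MulAction.toPerm g : Equiv.Perm X).tsum_eq]
    refine tsum_congr fun x => ?_
    rw [restr_apply]
    simp only [MulAction.toPerm_apply, ltrans_apply, inv_smul_smul]
    split_ifs <;> simp
  have sm : ∀ (g : G) (V : Set X), Summable fun x => (if g • x ∈ V then f x ^ 2 else 0) := by
    intro g V
    refine Summable.of_nonneg_of_le (fun x => by positivity) (fun x => ?_) (L2_summable f)
    split_ifs
    · exact le_rfl
    · positivity
  have k1 : ∀ V : Set X, ‖restr V f‖ ^ 2 = ∑' x, (if x ∈ V then f x ^ 2 else 0) := by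
    intro V
    have := key 1 V
    simpa [ltrans_one] using this
  have s1 : ∀ V : Set X, Summable fun x => (if x ∈ V then f x ^ 2 else 0) := by
    intro V
    simpa using sm 1 V
  -- covering
  have c1 : ‖f‖ ^ 2 ≤ ‖restr Vm f‖ ^ 2 + ‖restr Vp (ltrans t f)‖ ^ 2 := by
    rw [k1, key, ← (s1 Vm).tsum_add (sm t Vp), L2_norm_sq]
    refine (L2_summable f).tsum_le_tsum (fun x => ?_) ((s1 Vm).add (sm t Vp))
    have := sq_nonneg (f x)
    rcases hcov x with h | h <;> simp only [h, if_true] <;> split_ifs <;> linarith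
  have c2 : ‖restr Vp f‖ ^ 2 + ‖restr Vp (ltrans b f)‖ ^ 2 + ‖restr Vm f‖ ^ 2 +
      ‖restr Vm (ltrans a f)‖ ^ 2 ≤ ‖f‖ ^ 2 := by
    rw [k1, k1, key, key, ← (s1 Vp).tsum_add (sm b Vp),
      ← ((s1 Vp).add (sm b Vp)).tsum_add (s1 Vm),
      ← (((s1 Vp).add (sm b Vp)).add (s1 Vm)).tsum_add (sm a Vm), L2_norm_sq]
    refine Summable.tsum_le_tsum (fun x => ?_)
      ((((s1 Vp).add (sm b Vp)).add (s1 Vm)).add (sm a Vm)) (L2_summable f)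
    exact four_excl _ (sq_nonneg (f x)) (h1 x) (h2 x) (h3 x) (h4 x) (h5 x) (h6 x)
  have n1 := restr_near Vp (ltrans t f) f
  have n2 := restr_near Vp f (ltrans b f)
  have n3 := restr_near Vm f (ltrans a f)
  rw [norm_sub_rev] at n2 n3
  have l1 := restr_le Vp f
  have l2 := restr_le Vm f
  have p0 := norm_nonneg (restr Vp f)
  have m0 := norm_nonneg (restr Vm f)
  have p1 := norm_nonneg (restr Vp (ltrans b f))
  have m1 := norm_nonneg (restr Vm (ltrans a f))
  have t1 := norm_nonneg (restr Vp (ltrans t f))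
  have f0 := norm_nonneg f
  generalize ‖restr Vp f‖ = P at *
  generalize ‖restr Vm f‖ = M at *
  generalize ‖restr Vp (ltrans b f)‖ = P' at *
  generalize ‖restr Vm (ltrans a f)‖ = M' at *
  generalize ‖restr Vp (ltrans t f)‖ = T at *
  suffices h : ‖f‖ = 0 from norm_eq_zero.1 h
  generalize ‖f‖ = N at *
  have u1 : T ^ 2 ≤ P ^ 2 + 21 / 100 * N ^ 2 := by nlinarith
  have u2 : P ^ 2 ≤ P' ^ 2 + 1 / 5 * N ^ 2 := sq_near _ _ _ p0 p1 f0 (by linarith) l1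
  have u3 : M ^ 2 ≤ M' ^ 2 + 1 / 5 * N ^ 2 := sq_near _ _ _ m0 m1 f0 (by linarith) l2
  have : N ^ 2 ≤ 0 := by nlinarith
  nlinarith

/-- Elements of the closure move vectors by a bounded multiple of the displacement of generators. -/
theorem closure_displacement {α : Type*} (η : α → G) (g : G)
    (hg : g ∈ Subgroup.closure (Set.range η)) :
    ∃ M : ℝ, 0 ≤ M ∧ ∀ (f : L2 X) (c : ℝ), (∀ a, ‖ltrans (η a) f - f‖ ≤ c) → 0 ≤ c →
      ‖ltrans g f - f‖ ≤ M * c := by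
  induction hg using Subgroup.closure_induction with
  | mem x hx =>
    obtain ⟨a, rfl⟩ := hx
    exact ⟨1, zero_le_one, fun f c h _ => by simpa using h a⟩
  | one => exact ⟨0, le_rfl, fun f c h _ => by simp [ltrans_one]⟩
  | mul x y _ _ hx hy =>
    obtain ⟨M, hM, h⟩ := hx
    obtain ⟨M', hM', h'⟩ := hy
    refine ⟨M + M', by positivity, fun f c hf hc => ?_⟩
    have e : ltrans (x * y) f - f = ltrans x (ltrans y f - f) + (ltrans x f - f) := by
      rw [ltrans_mul, map_sub]; abel
    rw [e]
    refine (norm_add_le _ _).trans ?_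
    rw [LinearIsometry.norm_map]
    linarith [h f c hf hc, h' f c hf hc]
  | inv x _ hx =>
    obtain ⟨M, hM, h⟩ := hx
    refine ⟨M, hM, fun f c hf hc => ?_⟩
    have e : ltrans x (ltrans x⁻¹ f - f) = f - ltrans x f := by
      rw [map_sub, ← ltrans_mul, mul_inv_cancel, ltrans_one]
    rw [← LinearIsometry.norm_map (ltrans x), e, norm_sub_rev]
    exact h f c hf hc

theorem gap_gen {α : Type*} (η : α → G) (hη : Subgroup.closure (Set.range η) = ⊤)
    (a b t : G) (Vp Vm : Set X)
    (hcov : ∀ x, x ∈ Vm ∨ t • x ∈ Vp)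
    (h1 : ∀ x, x ∈ Vp → x ∈ Vm → False) (h2 : ∀ x, x ∈ Vp → b • x ∈ Vp → False)
    (h3 : ∀ x, x ∈ Vp → a • x ∈ Vm → False) (h4 : ∀ x, b • x ∈ Vp → x ∈ Vm → False)
    (h5 : ∀ x, b • x ∈ Vp → a • x ∈ Vm → False) (h6 : ∀ x, x ∈ Vm → a • x ∈ Vm → False) :
    ∃ δ : ℝ, 0 < δ ∧ ∀ f : L2 X, (∀ s, ‖ltrans (η s) f - f‖ ≤ δ * ‖f‖) → f = 0 := by
  have hm : ∀ g, g ∈ Subgroup.closure (Set.range η) := by simp [hη]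
  obtain ⟨Ma, hMa, ha⟩ := closure_displacement (X := X) η a (hm a)
  obtain ⟨Mb, hMb, hb⟩ := closure_displacement (X := X) η b (hm b)
  obtain ⟨Mt, hMt, ht⟩ := closure_displacement (X := X) η t (hm t)
  refine ⟨1 / (10 * (Ma + Mb + Mt + 1)), by positivity, fun f hf => ?_⟩
  have hS : 0 < Ma + Mb + Mt + 1 := by positivity
  have aux : ∀ M, M ≤ Ma + Mb + Mt + 1 →
      M * (1 / (10 * (Ma + Mb + Mt + 1)) * ‖f‖) ≤ 1 / 10 * ‖f‖ := by
    intro M hM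
    rw [← mul_assoc]
    refine mul_le_mul_of_nonneg_right ?_ (norm_nonneg _)
    rw [mul_one_div, div_le_div_iff₀ (by positivity) (by norm_num)]
    linarith
  have hc : 0 ≤ 1 / (10 * (Ma + Mb + Mt + 1)) * ‖f‖ := by positivity
  exact gap_three a b t Vp Vm hcov h1 h2 h3 h4 h5 h6 f
    ((ha f _ hf hc).trans (aux _ (by linarith))) ((hb f _ hf hc).trans (aux _ (by linarith)))
    ((ht f _ hf hc).trans (aux _ (by linarith)))

end Rep

section Tree

open HNNExtension HNNExtension.NormalWord

variable {H : Type*} [Group H] {A B : Subgroup H} {φ : A ≃* B}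

/-- Every element is the product of a reduced word. -/
theorem exists_reducedWord (g : HNNExtension H A B φ) :
    ∃ w : ReducedWord H A B, w.prod φ = g := by
  obtain ⟨d⟩ := TransversalPair.nonempty H A B
  exact ⟨(equiv φ d g).toReducedWord, (equiv φ d).left_inv g⟩

/-- Changing the last group element of a list of syllables keeps it reduced. -/
theorem chain_change_last (L : List (ℤˣ × H)) (u : ℤˣ) (k k' : H)
    (h : (L ++ [(u, k)]).IsChain (fun a b => a.2 ∈ toSubgroup A B a.1 → a.1 = b.1)) :
    (L ++ [(u, k')]).IsChain (fun a b => a.2 ∈ toSubgroup A B a.1 → a.1 = b.1) := by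
  rw [List.isChain_append] at h ⊢
  refine ⟨h.1, by simp, ?_⟩
  intro x hx y hy
  simp only [List.head?_cons, Option.mem_def, Option.some.injEq] at hy
  subst hy
  exact h.2.2 x hx (u, k) (by simp)

theorem rmul_reduced (w : ReducedWord H A B) (hw : w.toList ≠ []) (h : H) :
    ∃ w' : ReducedWord H A B, w'.head = w.head ∧
      w'.toList.map Prod.fst = w.toList.map Prod.fst ∧ w'.prod φ = w.prod φ * of h := by
  obtain ⟨g, l, hc⟩ := w
  rcases List.eq_nil_or_concat l with rfl | ⟨L, ⟨u, k⟩, rfl⟩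
  · exact absurd rfl hw
  · simp only [List.concat_eq_append] at hc ⊢
    refine ⟨⟨g, L ++ [(u, k * h)], chain_change_last L u k _ hc⟩, rfl, by simp, ?_⟩
    simp [ReducedWord.prod, mul_assoc]

/-- The half tree beyond the edge `t ^ u`. -/
def halfTree (φ : A ≃* B) (u : ℤˣ) :
    Set (HNNExtension H A B φ ⧸ (of : H →* HNNExtension H A B φ).range) :=
  {x | ∃ w : ReducedWord H A B, (QuotientGroup.mk (w.prod φ) :
      HNNExtension H A B φ ⧸ (of : H →* HNNExtension H A B φ).range) = x ∧
    w.toList.head?.map Prod.fst = some u ∧ w.head ∈ toSubgroup A B (-u)}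

theorem halfTree_disj (x : HNNExtension H A B φ ⧸ (of : H →* HNNExtension H A B φ).range)
    (h h' : H) (u u' : ℤˣ)
    (hx : (of h : HNNExtension H A B φ) • x ∈ halfTree φ u)
    (hx' : (of h' : HNNExtension H A B φ) • x ∈ halfTree φ u') :
    u = u' ∧ h * h'⁻¹ ∈ toSubgroup A B (-u) := by
  obtain ⟨w, hw1, hw2, hw3⟩ := hx
  obtain ⟨w', hw1', hw2', hw3'⟩ := hx'
  -- translate back
  have e1 : (QuotientGroup.mk ((of h)⁻¹ * w.prod φ) :
      HNNExtension H A B φ ⧸ (of : H →* HNNExtension H A B φ).range) = x := by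
    rw [← smul_eq_mul, ← MulAction.Quotient.smul_mk, inv_smul_eq_iff]; exact hw1
  have e2 : (QuotientGroup.mk ((of h')⁻¹ * w'.prod φ) :
      HNNExtension H A B φ ⧸ (of : H →* HNNExtension H A B φ).range) = x := by
    rw [← smul_eq_mul, ← MulAction.Quotient.smul_mk, inv_smul_eq_iff]; exact hw1'
  rw [← e2, QuotientGroup.eq] at e1
  obtain ⟨k, hk⟩ := e1
  have hne : w.toList ≠ [] := by rintro h0; simp [h0] at hw2
  obtain ⟨v, hv1, hv2, hv3⟩ := rmul_reduced (φ := φ) w hne k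
  set v1 : ReducedWord H A B := ⟨h⁻¹ * v.head, v.toList, v.chain⟩ with hv1d
  set v2 : ReducedWord H A B := ⟨h'⁻¹ * w'.head, w'.toList, w'.chain⟩ with hv2d
  have p1 : v1.prod φ = (of h)⁻¹ * (w.prod φ * of k) := by
    rw [← hv3]; simp [hv1d, ReducedWord.prod, mul_assoc]
  have p2 : v2.prod φ = (of h')⁻¹ * w'.prod φ := by
    simp [hv2d, ReducedWord.prod, mul_assoc]
  have pe : v1.prod φ = v2.prod φ := by
    rw [p1, p2, hk]; group
  have := ReducedWord.map_fst_eq_and_of_prod_eq φ pe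
  have q1 : v1.toList.head?.map Prod.fst = some u := by
    rw [← hw2, ← List.head?_map, ← List.head?_map]
    exact congrArg _ hv2
  have q2 : v2.toList.head?.map Prod.fst = some u' := hw2'
  have huu : u = u' := by
    rw [← List.head?_map, this.1, List.head?_map, q2] at q1
    exact (Option.some.inj q1).symm
  subst huu
  refine ⟨rfl, ?_⟩
  have m := this.2 u q1
  simp only [hv1d, hv2d, hv1, mul_inv_rev, inv_inv] at m
  have m2 := mul_mem (mul_mem hw3 m) (inv_mem hw3')
  simpa [mul_assoc] using m2

theorem halfTree_cov (x : HNNExtension H A B φ ⧸ (of : H →* HNNExtension H A B φ).range) :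
    x ∈ halfTree φ (-1) ∨ (t : HNNExtension H A B φ) • x ∈ halfTree φ 1 := by
  obtain ⟨g, rfl⟩ := QuotientGroup.mk_surjective x
  obtain ⟨w, rfl⟩ := exists_reducedWord g
  by_cases hc : w.head ∈ toSubgroup A B (1 : ℤˣ) ∧ w.toList.head?.map Prod.fst = some (-1)
  · left
    exact ⟨w, rfl, hc.2, by simpa using hc.1⟩
  · right
    refine ⟨⟨1, (1, w.head) :: w.toList, ?_⟩, ?_, rfl, one_mem _⟩
    · refine List.isChain_cons.2 ⟨?_, w.chain⟩
      rintro ⟨u', g'⟩ hu' hw1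
      simp only [Option.mem_def] at hu'
      by_contra hne
      refine hc ⟨hw1, ?_⟩
      rw [hu']
      simp only [Option.map_some, Option.some.injEq]
      exact (Int.units_ne_iff_eq_neg.1 (Ne.symm hne))
    · rw [MulAction.Quotient.smul_mk]
      simp [ReducedWord.prod, mul_assoc]

/-- The last syllable of the normal form. -/
noncomputable def br (d : TransversalPair H A B) (g : HNNExtension H A B φ) : Option (ℤˣ × H) :=
  (g • (empty : NormalWord d)).toList.getLast?

variable (d : TransversalPair H A B)

theorem prod_smul_empty' (g : HNNExtension H A B φ) :
    (g • (empty : NormalWord d)).prod φ = g := (equiv φ d).left_inv g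

theorem br_none (g : HNNExtension H A B φ) (h : br d g = none) :
    g ∈ (of : H →* HNNExtension H A B φ).range := by
  unfold br at h
  rw [List.getLast?_eq_none_iff] at h
  rw [← prod_smul_empty' d g]
  simp [ReducedWord.prod, h]

theorem br_of (h : H) (g : HNNExtension H A B φ) : br d (of h * g) = br d g := by
  simp [br, mul_smul, of_smul_eq_smul]

theorem br_t (g : HNNExtension H A B φ) :
    br d (t * g) = br d g ∨ br d g = none ∨ br d (t * g) = none := by
  unfold br
  rw [mul_smul, t_smul_eq_unitsSMul]
  generalize (g • (empty : NormalWord d)) = w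
  unfold unitsSMul
  split_ifs with hc
  · induction w using consRecOn with
    | ofGroup g => right; left; simp
    | cons g u w h1 h2 _ =>
      simp only [unitsSMulWithCancel, consRecOn_cons, group_smul_toList, cons_toList]
      rcases List.eq_nil_or_concat w.toList with h | ⟨L, x, h⟩
      · right; right; simp [h]
      · left; simp [h, List.getLast?_cons]
  · simp only [cons_toList, group_smul_toList]
    rcases List.eq_nil_or_concat w.toList with h | ⟨L, x, h⟩
    · right; left; simp [h]
    · left; simp [h, List.getLast?_cons]

theorem exists_Y (s : HNNExtension H A B φ) :
    ∃ Y : Finset (HNNExtension H A B φ ⧸ (of : H →* HNNExtension H A B φ).range),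
      ∀ g, br d (s * g) = br d g ∨ (QuotientGroup.mk g :
        HNNExtension H A B φ ⧸ (of : H →* HNNExtension H A B φ).range) ∈ Y := by
  classical
  induction s using HNNExtension.induction_on with
  | of h => exact ⟨∅, fun g => Or.inl (br_of d h g)⟩
  | t =>
    refine ⟨{QuotientGroup.mk 1, (t : HNNExtension H A B φ)⁻¹ • QuotientGroup.mk 1}, fun g => ?_⟩
    rcases br_t d g with h | h | h
    · exact Or.inl h
    · right
      have := br_none d _ h
      simp only [Finset.mem_insert, Finset.mem_singleton]
      left
      rw [eq_comm, QuotientGroup.eq]; simpa using this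
    · right
      have := br_none d _ h
      simp only [Finset.mem_insert, Finset.mem_singleton]
      right
      rw [eq_inv_smul_iff, MulAction.Quotient.smul_mk, eq_comm, QuotientGroup.eq]
      simpa using this
  | mul x y hx hy =>
    obtain ⟨Y1, h1⟩ := hx
    obtain ⟨Y2, h2⟩ := hy
    refine ⟨Y2 ∪ Y1.image (fun z => y⁻¹ • z), fun g => ?_⟩
    rcases h2 g with h | h
    · rcases h1 (y * g) with h' | h'
      · left; rw [mul_assoc, h', h]
      · right
        refine Finset.mem_union_right _ (Finset.mem_image.2 ⟨_, h', ?_⟩)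
        rw [MulAction.Quotient.smul_mk]; simp
    · right; exact Finset.mem_union_left _ h
  | inv x hx =>
    obtain ⟨Y, h⟩ := hx
    refine ⟨Y.image (fun z => x • z), fun g => ?_⟩
    rcases h (x⁻¹ * g) with h' | h'
    · left; rw [← h']; simp
    · right
      refine Finset.mem_image.2 ⟨_, h', ?_⟩
      rw [MulAction.Quotient.smul_mk]; simp

/-- Descent: if the last syllable is preserved by right multiplication by `h`, conjugate
with a shorter element. -/
theorem br_descent (x : HNNExtension H A B φ) (h : H)
    (hne : (x • (empty : NormalWord d)).toList ≠ [])
    (hbr : br d (x * of h) = br d x) :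
    ∃ (x' : HNNExtension H A B φ) (h' : H),
      (x' • (empty : NormalWord d)).toList.length < (x • (empty : NormalWord d)).toList.length ∧
      x * of h * x⁻¹ = x' * of h' * x'⁻¹ := by
  obtain ⟨⟨W, hWm⟩, hW⟩ : ∃ W, W = x • (empty : NormalWord d) := ⟨_, rfl⟩
  obtain ⟨⟨W2, hWm2⟩, hW2⟩ : ∃ W, W = (x * of h) • (empty : NormalWord d) := ⟨_, rfl⟩
  have px : W.prod φ = x := by
    have := prod_smul_empty' d x
    rwa [← hW] at this
  have px2 : W2.prod φ = x * of h := by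
    have := prod_smul_empty' d (x * of h)
    rwa [← hW2] at this
  unfold br at hbr
  rw [← hW, ← hW2] at hbr
  rw [← hW] at hne ⊢
  obtain ⟨g, l, hc⟩ := W
  obtain ⟨g2, l2, hc2⟩ := W2
  dsimp only at hbr hne ⊢
  rcases List.eq_nil_or_concat' l with rfl | ⟨L, ⟨u, k⟩, rfl⟩
  · exact absurd rfl hne
  rcases List.eq_nil_or_concat' l2 with rfl | ⟨L2, ⟨u2, k2⟩, rfl⟩
  · simp at hbr
  simp only [List.getLast?_append, List.getLast?_singleton, Option.some_or, Option.some.injEq,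
    Prod.mk.injEq] at hbr
  obtain ⟨rfl, rfl⟩ := hbr
  have cL : L.IsChain (fun a b : ℤˣ × H => a.2 ∈ toSubgroup A B a.1 → a.1 = b.1) :=
    (List.isChain_append.1 hc).1
  have cL2 : L2.IsChain (fun a b : ℤˣ × H => a.2 ∈ toSubgroup A B a.1 → a.1 = b.1) :=
    (List.isChain_append.1 hc2).1
  set P : HNNExtension H A B φ := ReducedWord.prod φ ⟨g, L, cL⟩ with hP
  set P2 : HNNExtension H A B φ := ReducedWord.prod φ ⟨g2, L2, cL2⟩ with hP2
  have ex : x = P * (t ^ (u2 : ℤ) * of k2) := by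
    rw [← px, hP]; simp [ReducedWord.prod, mul_assoc]
  have ex2 : x * of h = P2 * (t ^ (u2 : ℤ) * of k2) := by
    rw [← px2, hP2]; simp [ReducedWord.prod, mul_assoc]
  have hlen : L.length = L2.length := by
    have e3 : ReducedWord.prod φ ⟨g, L ++ [(u2, k2 * h)], chain_change_last L u2 k2 _ hc⟩ =
        ReducedWord.prod φ ⟨g2, L2 ++ [(u2, k2)], hc2⟩ := by
      rw [px2, ex, hP]; simp [ReducedWord.prod, mul_assoc]
    have := congrArg List.length (ReducedWord.map_fst_eq_and_of_prod_eq φ e3).1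
    simpa using this
  by_cases hm : k2 * h * k2⁻¹ ∈ toSubgroup A B u2
  · -- descent
    have hconj : ∃ h' : H, (t ^ (u2 : ℤ) * of (k2 * h * k2⁻¹) : HNNExtension H A B φ) =
        of h' * t ^ (u2 : ℤ) := by
      rcases Int.units_eq_one_or u2 with rfl | rfl
      · exact ⟨_, by simpa using t_mul_of (φ := φ) ⟨k2 * h * k2⁻¹, hm⟩⟩
      · exact ⟨_, by simpa using inv_t_mul_of (φ := φ) ⟨k2 * h * k2⁻¹, hm⟩⟩
    obtain ⟨h', hh'⟩ := hconj
    refine ⟨P, h', ?_, ?_⟩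
    · have hmL : ∀ (u : ℤˣ) (g : H), (u, g) ∈ L → g ∈ d.set u := fun u g hg =>
        hWm u g (by simp [hg])
      have : P • (empty : NormalWord d) = ⟨⟨g, L, cL⟩, hmL⟩ :=
        prod_smul_empty φ (⟨⟨g, L, cL⟩, hmL⟩ : NormalWord d)
      rw [this]; simp
    · have e4 : x * of h * x⁻¹ = P * (t ^ (u2 : ℤ) * of (k2 * h * k2⁻¹)) *
          (t ^ (u2 : ℤ))⁻¹ * P⁻¹ := by
        rw [ex]; simp only [map_mul, map_inv]; group
      rw [e4, hh']; group
  · exfalso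
    have c5 : (L ++ [(u2, k2 * h * k2⁻¹), (-u2, 1)]).IsChain
        (fun a b : ℤˣ × H => a.2 ∈ toSubgroup A B a.1 → a.1 = b.1) := by
      have := chain_change_last L u2 k2 (k2 * h * k2⁻¹) hc
      rw [List.isChain_append] at this ⊢
      refine ⟨this.1, ?_, ?_⟩
      · simp only [List.isChain_cons_cons, List.isChain_singleton, and_true]
        intro h'; exact absurd h' hm
      · simpa using this.2.2
    have e5 : ReducedWord.prod φ ⟨g, L ++ [(u2, k2 * h * k2⁻¹), (-u2, 1)], c5⟩ = P2 := by
      have : P2 = x * of h * (of k2)⁻¹ * (t ^ (u2 : ℤ))⁻¹ := by rw [ex2]; group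
      rw [this, ex, hP]
      simp [ReducedWord.prod, mul_assoc]
    have := congrArg List.length (ReducedWord.map_fst_eq_and_of_prod_eq φ e5).1
    simp at this
    omega

end Tree

section Counting

variable {α : Type*} [Fintype α] [DecidableEq α]

/-- Words of length `n` that may follow the letter `a` in a reduced word. -/
def redFin (inv : α → α) : ℕ → α → Finset (List α)
  | 0, _ => {[]}
  | n + 1, a => (Finset.univ.filter (fun b => b ≠ inv a)).biUnion
      (fun b => (redFin inv n b).image (List.cons b))

theorem mem_redFin (inv : α → α) (n : ℕ) (a : α) (w : List α) :
    w ∈ redFin inv n a ↔ w.length = n ∧ Reduced inv (a :: w) := by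
  unfold Reduced
  induction n generalizing a w with
  | zero =>
    simp only [redFin, Finset.mem_singleton, List.length_eq_zero_iff]
    constructor
    · rintro rfl; exact ⟨rfl, List.isChain_singleton _⟩
    · exact fun h => h.1
  | succ n ih =>
    simp only [redFin, Finset.mem_biUnion, Finset.mem_filter, Finset.mem_univ, true_and,
      Finset.mem_image]
    constructor
    · rintro ⟨b, hb, w', hw', rfl⟩
      rw [ih] at hw'
      exact ⟨by simp [hw'.1], List.isChain_cons_cons.2 ⟨hb, hw'.2⟩⟩
    · rintro ⟨h1, h2⟩
      match w, h1 with
      | b :: w', h1 =>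
        have := List.isChain_cons_cons.1 h2
        exact ⟨b, this.1, w', (ih b w').2 ⟨by simpa using h1, this.2⟩, rfl⟩

theorem redFin_disj (inv : α → α) (n : ℕ) (s : Finset α) :
    (s : Set α).PairwiseDisjoint (fun b => (redFin inv n b).image (List.cons b)) := by
  intro b _ b' _ hbb
  rw [Function.onFun, Finset.disjoint_left]
  intro w hw hw'
  simp only [Finset.mem_image] at hw hw'
  obtain ⟨v, _, rfl⟩ := hw
  obtain ⟨v', _, h⟩ := hw'
  exact hbb (List.cons.inj h).1.symm

theorem card_redFin (inv : α → α) (n : ℕ) (a : α) :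
    ((redFin inv n a).card : ℝ) = ((Fintype.card α : ℝ) - 1) ^ n := by
  induction n generalizing a with
  | zero => simp [redFin]
  | succ n ih =>
    rw [redFin, Finset.card_biUnion (redFin_disj inv n _)]
    push_cast
    have : ∀ b, (((redFin inv n b).image (List.cons b)).card : ℝ) =
        ((Fintype.card α : ℝ) - 1) ^ n := by
      intro b
      rw [Finset.card_image_of_injective _ (List.cons_injective), ih]
    simp only [this, Finset.sum_const, nsmul_eq_mul, card_filter_ne]
    ring

variable {G X : Type*} [Group G] [MulAction G X] [DecidableEq X]

theorem nbOp_iterate_eq (inv : α → α) (η : α → G) (y : X) (n : ℕ) (a : α) :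
    (nbOp inv (fun b => ltrans (X := X) (η b)))^[n] (fun _ => lp.single 2 y (1 : ℝ)) a =
      ∑ w ∈ redFin inv n a, (lp.single 2 (evalWord η w • y) (1 : ℝ) : L2 X) := by
  induction n generalizing a with
  | zero => simp [redFin, evalWord]
  | succ n ih =>
    rw [Function.iterate_succ_apply', nbOp, redFin, Finset.sum_biUnion (redFin_disj inv n _)]
    refine Finset.sum_congr rfl fun b _ => ?_
    rw [ih, map_sum, Finset.sum_image (fun _ _ _ _ h => List.cons_injective h)]
    refine Finset.sum_congr rfl fun w _ => ?_
    rw [ltrans_single]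
    simp [evalWord, mul_smul]

theorem fix_count_le (inv : α → α) (η : α → G) (y : X) (n : ℕ) (a : α) :
    (((redFin inv n a).filter (fun w => evalWord η w • y = y)).card : ℝ) ^ 2 ≤
      sqn ((nbOp inv (fun b => ltrans (X := X) (η b)))^[n] (fun _ => lp.single 2 y (1 : ℝ))) := by
  set F := (nbOp inv (fun b => ltrans (X := X) (η b)))^[n] (fun _ => lp.single 2 y (1 : ℝ))
    with hF
  have h1 : F a y = (((redFin inv n a).filter (fun w => evalWord η w • y = y)).card : ℝ) := by
    rw [hF, nbOp_iterate_eq, lp.coeFn_sum, Finset.sum_apply]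
    simp only [lp.single_apply, Pi.single_apply, Finset.sum_ite, Finset.sum_const_zero, add_zero,
      Finset.sum_const, nsmul_eq_mul, mul_one, eq_comm]
  have h2 : ‖F a y‖ ≤ ‖F a‖ := lp.norm_apply_le_norm (by simp) _ _
  rw [← h1, ← sq_abs, ← Real.norm_eq_abs]
  calc ‖F a y‖ ^ 2 ≤ ‖F a‖ ^ 2 := pow_le_pow_left₀ (norm_nonneg _) h2 2
    _ ≤ sqn F := Finset.single_le_sum (f := fun a => ‖F a‖ ^ 2) (fun _ _ => by positivity)
      (Finset.mem_univ a)

theorem fix_count_decay (inv : α → α) (hinv : ∀ a, inv (inv a) = a)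
    (hcard : 3 ≤ Fintype.card α) (η : α → G) (hη : ∀ a, η (inv a) = (η a)⁻¹)
    (hgap : ∃ δ : ℝ, 0 < δ ∧ ∀ f : L2 X, (∀ s, ‖ltrans (η s) f - f‖ ≤ δ * ‖f‖) → f = 0) :
    ∃ C σ : ℝ, 0 < C ∧ 0 < σ ∧ σ < 1 ∧ ∀ (y : X) (n : ℕ) (a : α),
      (((redFin inv n a).filter (fun w => evalWord η w • y = y)).card : ℝ) ≤
        C * (σ ^ n * ((Fintype.card α : ℝ) - 1) ^ n) := by
  obtain ⟨δ, hδ, hgap⟩ := hgap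
  obtain ⟨σ, h0, h1, h⟩ := nbOp_iterate_decay inv hinv hcard
    (fun b => ltrans (X := X) (η b))
    (fun a x => by
      change ltrans (η a) (ltrans (η (inv a)) x) = x
      rw [hη, ← ltrans_mul, mul_inv_cancel, ltrans_one])
    {f | ∀ x, 0 ≤ f x}
    (fun a f hf x => hf _) (fun x => le_rfl)
    (fun f hf g hg x => add_nonneg (hf x) (hg x))
    (fun f hf g hg => by
      rw [lp.inner_eq_tsum]
      refine tsum_nonneg fun x => ?_
      simpa using mul_nonneg (hg x) (hf x))
    δ hδ hgap
  have hq : (2 : ℝ) ≤ (Fintype.card α : ℝ) - 1 := by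
    have : (3 : ℝ) ≤ Fintype.card α := by exact_mod_cast hcard
    linarith
  refine ⟨(Fintype.card α : ℝ) / σ, σ, by apply div_pos <;> linarith, h0, h1, ?_⟩
  intro y n a
  have h2 := fix_count_le inv η y n a
  have h3 := h (fun _ => lp.single 2 y (1 : ℝ)) (fun a x => by
    rw [lp.single_apply, Pi.single_apply]; split_ifs <;> simp) n
  have h4 : sqn (fun _ : α => (lp.single 2 y (1 : ℝ) : L2 X)) = Fintype.card α := by
    simp [sqn, lp.norm_single]
  rw [h4] at h3
  set q : ℝ := (Fintype.card α : ℝ) - 1 with hqd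
  have hN : (Fintype.card α : ℝ) = q + 1 := by rw [hqd]; ring
  rw [div_mul_eq_mul_div, le_div_iff₀ h0]
  refine abs_le_of_sq_le_sq' ?_ (by rw [hN]; positivity) |>.2
  rw [hN] at h3 ⊢
  have h5 : (q + 1) ≤ (q + 1) ^ 2 := by nlinarith
  calc _ = σ ^ 2 * (((redFin inv n a).filter (fun w => evalWord η w • y = y)).card : ℝ) ^ 2 := by
        ring
    _ ≤ _ := mul_le_mul_of_nonneg_left h2 (by positivity)
    _ ≤ _ := h3
    _ ≤ (σ ^ n * q ^ n) ^ 2 * (q + 1) ^ 2 := mul_le_mul_of_nonneg_left h5 (by positivity)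
    _ = _ := by ring

end Counting

section Final

open HNNExtension HNNExtension.NormalWord

variable {H : Type*} [Group H] {A B : Subgroup H} {φ : A ≃* B}

theorem evalWord_append {α G : Type*} [Monoid G] (η : α → G) (u v : List α) :
    evalWord η (u ++ v) = evalWord η u * evalWord η v := by simp [evalWord]

theorem word_path {α : Type*} (d : TransversalPair H A B) (η : α → HNNExtension H A B φ)
    (Y : Finset (HNNExtension H A B φ ⧸ (of : H →* HNNExtension H A B φ).range))
    (hY : ∀ a g, br d (η a * g) = br d g ∨ (QuotientGroup.mk g :
        HNNExtension H A B φ ⧸ (of : H →* HNNExtension H A B φ).range) ∈ Y)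
    (x : HNNExtension H A B φ) (w : List α) :
    br d (evalWord η w * x) = br d x ∨ ∃ u v, w = u ++ v ∧ (QuotientGroup.mk (evalWord η v * x) :
        HNNExtension H A B φ ⧸ (of : H →* HNNExtension H A B φ).range) ∈ Y := by
  induction w with
  | nil => left; simp [evalWord]
  | cons a w ih =>
    rcases ih with h | ⟨u, v, rfl, h⟩
    · rcases hY a (evalWord η w * x) with h' | h'
      · left
        rw [← h, ← h', ← mul_assoc]
        simp [evalWord]
      · right
        exact ⟨[a], w, rfl, h'⟩
    · right
      exact ⟨a :: u, v, rfl, h⟩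

theorem elliptic_rotate {α : Type*} (d : TransversalPair H A B) (η : α → HNNExtension H A B φ)
    (Y : Finset (HNNExtension H A B φ ⧸ (of : H →* HNNExtension H A B φ).range))
    (hY : ∀ a g, br d (η a * g) = br d g ∨ (QuotientGroup.mk g :
        HNNExtension H A B φ ⧸ (of : H →* HNNExtension H A B φ).range) ∈ Y)
    (hY1 : (QuotientGroup.mk 1 :
        HNNExtension H A B φ ⧸ (of : H →* HNNExtension H A B φ).range) ∈ Y)
    (w : List α) (n : ℕ) (x : HNNExtension H A B φ) (h : H)
    (hn : (x • (empty : NormalWord d)).toList.length = n)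
    (hw : evalWord η w = x * of h * x⁻¹) :
    ∃ u v, w = u ++ v ∧ ∃ y ∈ Y, evalWord η (v ++ u) • y = y := by
  induction n using Nat.strong_induction_on generalizing x h with
  | _ n ih =>
    by_cases hx : (x • (empty : NormalWord d)).toList = []
    · refine ⟨w, [], by simp, _, hY1, ?_⟩
      have hxr : x ∈ (of : H →* HNNExtension H A B φ).range :=
        br_none d x (by simp [br, hx])
      rw [MulAction.Quotient.smul_mk, eq_comm, QuotientGroup.eq]
      simp only [List.nil_append, hw, inv_one, one_mul, smul_eq_mul, mul_one]
      exact mul_mem (mul_mem hxr ⟨h, rfl⟩) (inv_mem hxr)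
    · have e : evalWord η w * x = x * of h := by rw [hw]; group
      rcases word_path d η Y hY x w with hb | ⟨u, v, rfl, hv⟩
      · rw [e] at hb
        obtain ⟨x', h', hlt, he⟩ := br_descent d x h hx hb
        exact ih _ (hn ▸ hlt) x' h' rfl (hw.trans he)
      · refine ⟨u, v, rfl, _, hv, ?_⟩
        rw [MulAction.Quotient.smul_mk, eq_comm, QuotientGroup.eq]
        refine ⟨h, ?_⟩
        rw [evalWord_append] at e ⊢
        have e' : of h = x⁻¹ * (evalWord η u * evalWord η v * x) := by rw [e]; group
        rw [e', smul_eq_mul]; group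

/-- The alphabet has at least three letters. -/
theorem card_ge_three {α : Type*} [Fintype α] (η : α → HNNExtension H A B φ) (inv : α → α)
    (hsym : IsSymmetricGen η inv) (a : H) (ha : a ∉ A) : 3 ≤ Fintype.card α := by
  classical
  obtain ⟨h1, h2, h3, h4⟩ := hsym
  by_contra! hlt
  have hab : ∀ b c : α, c = b ∨ c = inv b := by
    intro b c
    by_contra! hne
    have : ({b, inv b, c} : Finset α).card = 3 := by
      rw [Finset.card_eq_three]
      exact ⟨b, inv b, c, (h2 b).symm, hne.1.symm, hne.2.symm, rfl⟩
    have := Finset.card_le_univ ({b, inv b, c} : Finset α)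
    omega
  have hcomm : ∀ x y : HNNExtension H A B φ, x * y = y * x := by
    intro x y
    have hx : x ∈ Subgroup.closure (Set.range η) := by simp [h4]
    have hy : y ∈ Subgroup.closure (Set.range η) := by simp [h4]
    have hc : Subgroup.closure (Set.range η) ≤
        Subgroup.centralizer (Subgroup.closure (Set.range η) : Set (HNNExtension H A B φ)) := by
      rw [Subgroup.centralizer_closure, Subgroup.closure_le]
      rintro _ ⟨b, rfl⟩
      simp only [SetLike.mem_coe, Subgroup.mem_centralizer_iff]
      rintro _ ⟨c, rfl⟩
      rcases hab b c with rfl | rfl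
      · rfl
      · rw [h3]; simp
    exact (Subgroup.mem_centralizer_iff.1 (hc hy)) x hx
  let w : ReducedWord H A B := ⟨1, [(1, a), (-1, 1)], by
    simp only [List.isChain_cons_cons, List.isChain_singleton, and_true, toSubgroup_one]
    exact fun h => absurd h ha⟩
  have : w.prod φ ∈ (of : H →* HNNExtension H A B φ).range := by
    refine ⟨a, ?_⟩
    have := hcomm t (of a)
    simp [w, ReducedWord.prod, this]
  have := ReducedWord.toList_eq_nil_of_mem_of_range φ w this
  simp [w] at this

theorem exists_not_mem_of_two_le (A : Subgroup H) (hA : 2 ≤ Cardinal.mk (H ⧸ A)) :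
    ∃ a, a ∉ A := by
  by_contra! h
  have : Subsingleton (H ⧸ A) := ⟨fun x y => by
    obtain ⟨x, rfl⟩ := QuotientGroup.mk_surjective x
    obtain ⟨y, rfl⟩ := QuotientGroup.mk_surjective y
    exact QuotientGroup.eq.2 (h _)⟩
  have h1 := Cardinal.le_one_iff_subsingleton.2 this
  exact absurd (hA.trans h1) (by norm_num)

theorem hnn_gap {α : Type*} (η : α → HNNExtension H A B φ)
    (hη : Subgroup.closure (Set.range η) = ⊤) (a b : H) (ha : a ∉ A) (hb : b ∉ B) :
    ∃ δ : ℝ, 0 < δ ∧ ∀ f : L2 (HNNExtension H A B φ ⧸ (of : H →* HNNExtension H A B φ).range),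
      (∀ s, ‖ltrans (η s) f - f‖ ≤ δ * ‖f‖) → f = 0 := by
  have o1 : (of (1 : H) : HNNExtension H A B φ) = 1 := map_one _
  have D := halfTree_disj (φ := φ)
  have hne : (1 : ℤˣ) ≠ -1 := by decide
  refine gap_gen η hη (of a) (of b) t (halfTree φ 1) (halfTree φ (-1)) halfTree_cov ?_ ?_ ?_ ?_ ?_ ?_
  · intro x hx hx'
    have := D x 1 1 1 (-1) (by rwa [o1, one_smul]) (by rwa [o1, one_smul])
    exact hne this.1
  · intro x hx hx'
    have := D x b 1 1 1 hx' (by rwa [o1, one_smul])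
    exact hb (by simpa using this.2)
  · intro x hx hx'
    have := D x 1 a 1 (-1) (by rwa [o1, one_smul]) hx'
    exact hne this.1
  · intro x hx hx'
    have := D x b 1 1 (-1) hx (by rwa [o1, one_smul])
    exact hne this.1
  · intro x hx hx'
    have := D x b a 1 (-1) hx hx'
    exact hne this.1
  · intro x hx hx'
    have := D x a 1 (-1) (-1) hx' (by rwa [o1, one_smul])
    exact ha (by simpa using this.2)

end Final

/-- For an HNN extension `G = ⟨H, t | t a t⁻¹ = φ(a), a ∈ A⟩` with
`[H:A] ≥ 2`, `[H:B] ≥ 2` and a finite symmetric generating set `η : Σ → G`, there are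
constants `C > 0`, `0 < ρ < 1` such that for every `n` the number of cyclically reduced
words of length `n` representing elliptic elements is at most `C·ρⁿ` times the number of
all reduced words of length `n`. -/
theorem stmt_14 {H : Type*} [Group H] (A B : Subgroup H) (φ : A ≃* B)
    (hA : 2 ≤ Cardinal.mk (H ⧸ A)) (hB : 2 ≤ Cardinal.mk (H ⧸ B))
    {α : Type*} [Fintype α] (η : α → HNNExtension H A B φ) (inv : α → α)
    (hsym : IsSymmetricGen η inv) :
    ∃ C ρ : ℝ, 0 < C ∧ 0 < ρ ∧ ρ < 1 ∧ ∀ n : ℕ,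
      (wordCount {w : List α | CyclicallyReduced inv w ∧
          IsElliptic ((HNNExtension.of : H →* HNNExtension H A B φ).range : Set _)
            (evalWord η w)} n : ℝ) ≤
        C * ρ ^ n * (wordCount {w : List α | Reduced inv w} n : ℝ) := by
  classical
  obtain ⟨a, ha⟩ := exists_not_mem_of_two_le A hA
  obtain ⟨b, hb⟩ := exists_not_mem_of_two_le B hB
  have hcard := card_ge_three η inv hsym a ha
  obtain ⟨h1, h2, h3, h4⟩ := hsym
  obtain ⟨C, σ, hC, hσ0, hσ1, hdec⟩ := fix_count_decay inv h1 hcard η h3 (hnn_gap η h4 a b ha hb)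
  obtain ⟨d⟩ := HNNExtension.NormalWord.TransversalPair.nonempty H A B
  choose Y0 hY0 using fun s : α => exists_Y d (η s)
  set Y : Finset (HNNExtension H A B φ ⧸ (HNNExtension.of : H →* HNNExtension H A B φ).range) :=
    insert (QuotientGroup.mk 1) (Finset.univ.biUnion Y0) with hYd
  have hY1 : (QuotientGroup.mk 1 :
      HNNExtension H A B φ ⧸ (HNNExtension.of : H →* HNNExtension H A B φ).range) ∈ Y :=
    Finset.mem_insert_self _ _
  have hY : ∀ s g, br d (η s * g) = br d g ∨ (QuotientGroup.mk g :
      HNNExtension H A B φ ⧸ (HNNExtension.of : H →* HNNExtension H A B φ).range) ∈ Y := by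
    intro s g
    rcases hY0 s g with h | h
    · exact Or.inl h
    · exact Or.inr (Finset.mem_insert_of_mem (Finset.mem_biUnion.2 ⟨s, Finset.mem_univ _, h⟩))
  set q : ℝ := (Fintype.card α : ℝ) - 1 with hq
  have hq2 : 2 ≤ q := by
    have : (3 : ℝ) ≤ Fintype.card α := by exact_mod_cast hcard
    linarith
  have hne : Nonempty α := Fintype.card_pos_iff.1 (by omega)
  -- the finite set of reduced words with a fixed point in `Y`
  let T : ℕ → Finset (List α) := fun n => Y.biUnion fun y => Finset.univ.biUnion fun c =>
    (redFin inv n c).filter (fun w => evalWord η w • y = y)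
  have hT : ∀ n, ((T n).card : ℝ) ≤ (Y.card : ℝ) * (Fintype.card α * (C * (σ ^ n * q ^ n))) := by
    intro n
    have e1 : (T n).card ≤ ∑ y ∈ Y, ∑ c : α,
        ((redFin inv n c).filter (fun w => evalWord η w • y = y)).card :=
      Finset.card_biUnion_le.trans (Finset.sum_le_sum fun y _ => Finset.card_biUnion_le)
    calc ((T n).card : ℝ) ≤ ∑ y ∈ Y, ∑ c : α,
        (((redFin inv n c).filter (fun w => evalWord η w • y = y)).card : ℝ) := by
          exact_mod_cast e1
      _ ≤ ∑ y ∈ Y, ∑ c : α, C * (σ ^ n * q ^ n) :=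
        Finset.sum_le_sum fun y _ => Finset.sum_le_sum fun c _ => hdec y n c
      _ = _ := by simp
  -- the elliptic words are rotations of these
  have hmem : ∀ n (w : List α), CyclicallyReduced inv w →
      IsElliptic ((HNNExtension.of : H →* HNNExtension H A B φ).range : Set _) (evalWord η w) →
      w.length = n → w ∈ (Finset.range (n + 1)).biUnion fun j =>
        (T n).image (fun w' => w'.rotate j) := by
    intro n w hw1 hw2 hwn
    obtain ⟨_, ⟨h, rfl⟩, hc⟩ := hw2
    obtain ⟨x, hx⟩ := isConj_iff.1 hc
    obtain ⟨u, v, rfl, y, hy, hfix⟩ := elliptic_rotate d η Y hY hY1 w _ x h rfl hx.symm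
    have hred : Reduced inv (v ++ u) := by
      have hw3 : List.IsChain (fun a b => b ≠ inv a) (u ++ v ++ (u ++ v)) := hw1
      refine List.IsChain.infix hw3 ⟨u, v, ?_⟩
      simp
    have hredc : ∃ c, Reduced inv (c :: (v ++ u)) := by
      rcases hvu : v ++ u with _ | ⟨c, l⟩
      · obtain ⟨c⟩ := hne
        exact ⟨c, List.isChain_singleton _⟩
      · rw [hvu] at hred
        exact ⟨c, List.isChain_cons_cons.2 ⟨(h2 c).symm, hred⟩⟩
    obtain ⟨c, hc⟩ := hredc
    have hlen : (v ++ u).length = n := by rw [← hwn]; simp [add_comm]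
    refine Finset.mem_biUnion.2 ⟨v.length, ?_, Finset.mem_image.2 ⟨v ++ u, ?_, ?_⟩⟩
    · simp only [List.length_append] at hlen
      simp only [Finset.mem_range]; omega
    · refine Finset.mem_biUnion.2 ⟨y, hy, Finset.mem_biUnion.2 ⟨c, Finset.mem_univ _, ?_⟩⟩
      exact Finset.mem_filter.2 ⟨(mem_redFin inv n c _).2 ⟨hlen, hc⟩, hfix⟩
    · exact List.rotate_append_length_eq v u
  have hcount : ∀ n, (wordCount {w : List α | CyclicallyReduced inv w ∧
          IsElliptic ((HNNExtension.of : H →* HNNExtension H A B φ).range : Set _)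
            (evalWord η w)} n : ℝ) ≤ (n + 1) * (T n).card := by
    intro n
    have e1 : wordCount {w : List α | CyclicallyReduced inv w ∧
          IsElliptic ((HNNExtension.of : H →* HNNExtension H A B φ).range : Set _)
            (evalWord η w)} n ≤ ((Finset.range (n + 1)).biUnion fun j =>
        (T n).image (fun w' => w'.rotate j)).card := by
      rw [wordCount, ← Nat.card_eq_finsetCard]
      exact Nat.card_le_card_of_injective
        (fun w => ⟨w.1, hmem n w.1 w.2.1.1 w.2.1.2 w.2.2⟩)
        (fun w w' h => Subtype.ext (congrArg (fun z => z.1) h))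
    have e2 : ((Finset.range (n + 1)).biUnion fun j =>
        (T n).image (fun w' => w'.rotate j)).card ≤ (n + 1) * (T n).card := by
      refine Finset.card_biUnion_le.trans ?_
      refine (Finset.sum_le_card_nsmul _ _ _ fun j _ => Finset.card_image_le).trans ?_
      simp
    exact_mod_cast e1.trans e2
  have hlow : ∀ n, q ^ n ≤ (wordCount {w : List α | Reduced inv w} n : ℝ) := by
    intro n
    obtain ⟨c⟩ := hne
    rw [hq, ← card_redFin inv n c]
    have hfin : Finite {w : List α // w ∈ {w : List α | Reduced inv w} ∧ w.length = n} :=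
      ((List.finite_length_eq α n).subset
        (t := {w : List α | w ∈ {w : List α | Reduced inv w} ∧ w.length = n})
        (fun w hw => hw.2)).to_subtype
    rw [wordCount, ← Nat.card_eq_finsetCard]
    norm_cast
    refine Nat.card_le_card_of_injective
      (fun w : redFin inv n c => ⟨w.1, ?_, ?_⟩) ?_
    · have := ((mem_redFin inv n c w.1).1 w.2).2
      exact List.IsChain.tail this
    · exact ((mem_redFin inv n c w.1).1 w.2).1
    · exact fun w w' h => Subtype.ext (congrArg (fun z => z.1) h)
  -- absorb the linear factor
  set ε : ℝ := (1 - σ) / 2 with hε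
  have hε0 : 0 < ε := by rw [hε]; linarith
  have hε1 : ε ≤ 1 := by rw [hε]; linarith
  have hlin : ∀ n : ℕ, (n + 1 : ℝ) ≤ 1 / ε * (1 + ε) ^ n := by
    intro n
    have := one_add_mul_le_pow (a := ε) (by linarith) n
    rw [one_div, ← div_eq_inv_mul, le_div_iff₀ hε0]
    nlinarith
  have hY0' : (0 : ℝ) < Y.card := by exact_mod_cast Finset.card_pos.2 ⟨_, hY1⟩
  have hα0 : (0 : ℝ) < Fintype.card α := by exact_mod_cast (by omega : 0 < Fintype.card α)
  refine ⟨1 / ε * (Y.card * (Fintype.card α * C)), (1 + ε) * σ, by positivity, by positivity, ?_, ?_⟩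
  · rw [hε]; nlinarith
  intro n
  have hw0 := hlow n
  calc _ ≤ (n + 1) * ((T n).card : ℝ) := hcount n
    _ ≤ (1 / ε * (1 + ε) ^ n) * ((Y.card : ℝ) * (Fintype.card α * (C * (σ ^ n * q ^ n)))) :=
      mul_le_mul (hlin n) (hT n) (by positivity) (by positivity)
    _ = 1 / ε * (Y.card * (Fintype.card α * C)) * ((1 + ε) * σ) ^ n * q ^ n := by
      rw [mul_pow]; ring
    _ ≤ _ := mul_le_mul_of_nonneg_left hw0 (by positivity)
end

section
/- Let G = H ∗_A K be an amalgamated free product with [H : A] ≥ 3 and [K : A] ≥ 2, let P be the canonical image of H or of K in G, let η : Σ → G be a finite symmetric generating set, and let d denote the word metric on the right coset space P\G (where d(Pg, Pg') is the least length of a word w over Σ with Pg·(element represented by w) = Pg'). Then there exist a map f : P\G → P\G and a constant k ∈ ℕ such that d(f(x), x) ≤ k for every coset x, and every fiber f⁻¹(x) contains at least 2 elements; that is, the Schreier graph of G with respect to P satisfies the Gromov condition. -/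
universe u

open Monoid

/-- The two-element family of groups used to realize `H ∗_A K` as a pushout. -/
def AmalgFam (H K : Type u) : Bool → Type u
  | true => H
  | false => K

instance amalgFamGroup {H K : Type u} [Group H] [Group K] : (b : Bool) → Group (AmalgFam H K b)
  | true => ‹Group H›
  | false => ‹Group K›

/-- The two inclusions of the amalgamated subgroup `A`. -/
def amalgMaps {A : Type*} [Group A] {H K : Type u} [Group H] [Group K]
    (φ : A →* H) (ψ : A →* K) : (b : Bool) → A →* AmalgFam H K b
  | true => φ
  | false => ψ

/-- The amalgamated free product `H ∗_A K`, i.e. the pushout of the two inclusions of `A`. -/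
abbrev AmalgProd {A : Type*} [Group A] {H K : Type u} [Group H] [Group K]
    (φ : A →* H) (ψ : A →* K) : Type _ :=
  Monoid.PushoutI (amalgMaps φ ψ)

/-- The canonical map `H →* H ∗_A K`. -/
def amalgH {A : Type*} [Group A] {H K : Type u} [Group H] [Group K]
    (φ : A →* H) (ψ : A →* K) : H →* AmalgProd φ ψ :=
  Monoid.PushoutI.of (φ := amalgMaps φ ψ) true

/-- The canonical map `K →* H ∗_A K`. -/
def amalgK {A : Type*} [Group A] {H K : Type u} [Group H] [Group K]
    (φ : A →* H) (ψ : A →* K) : K →* AmalgProd φ ψ :=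
  Monoid.PushoutI.of (φ := amalgMaps φ ψ) false

/-- The word metric on the right coset space `P\G`: the least length of a word `w` over
`α` such that `Pg·(evalWord η w) = Pg'`. -/
noncomputable def cosetDist {G : Type*} [Group G] (P : Subgroup G) {α : Type*}
    (η : α → G) (x y : Quotient (QuotientGroup.rightRel P)) : ℕ :=
  sInf {n : ℕ | ∃ w : List α, w.length = n ∧ ∃ g : G,
    x = Quotient.mk (QuotientGroup.rightRel P) g ∧
    y = Quotient.mk (QuotientGroup.rightRel P) (g * evalWord η w)}

open Monoid.PushoutI Monoid.PushoutI.NormalWord in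
theorem aux_fst_smul {ι A : Type*} {G : ι → Type*} [∀ i, Group (G i)] [Group A]
    [DecidableEq ι] [∀ i, DecidableEq (G i)]
    {φ : ∀ i, A →* G i} {d : Transversal φ} {i : ι} (g : G i) (hg : g ∉ (φ i).range)
    (w : NormalWord d) (hw : w.fstIdx ≠ some i) :
    (of (φ := φ) i g • w).fstIdx = some i := by
  rw [← cons_eq_smul g w hw hg]
  simp [NormalWord.cons]

open Monoid.PushoutI Monoid.PushoutI.NormalWord in
theorem aux_fst_base {ι A : Type*} {G : ι → Type*} [∀ i, Group (G i)] [Group A]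
    [DecidableEq ι] [∀ i, DecidableEq (G i)]
    {φ : ∀ i, A →* G i} {d : Transversal φ} (a : A)
    (w : NormalWord d) : (base φ a • w).fstIdx = w.fstIdx := by
  rw [base_smul_def]

open Monoid.PushoutI Monoid.PushoutI.NormalWord in
theorem aux_fst_of_empty {A : Type*} {G : Bool → Type*} [∀ i, Group (G i)] [Group A]
    [∀ i, DecidableEq (G i)]
    {φ : ∀ i, A →* G i} {d : Transversal φ} {b : Bool} (g : G b) :
    (of (φ := φ) b g • (NormalWord.empty : NormalWord d)).fstIdx ≠ some (!b) := by
  have he : (NormalWord.empty : NormalWord d).fstIdx = none := rfl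
  by_cases hg : g ∈ (φ b).range
  · obtain ⟨a, rfl⟩ := hg
    rw [of_apply_eq_base, aux_fst_base, he]
    simp
  · rw [aux_fst_smul g hg _ (by rw [he]; simp)]
    simp

open Monoid.PushoutI Monoid.PushoutI.NormalWord in
theorem aux_inv {A : Type*} {G : Bool → Type*} [∀ i, Group (G i)] [Group A]
    [∀ i, DecidableEq (G i)]
    {φ : ∀ i, A →* G i} {d : Transversal φ} {b : Bool} (h : G b) (w : NormalWord d) :
    (w.prod • (of (φ := φ) b h • (NormalWord.empty : NormalWord d))).fstIdx = some (!b) ↔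
      w.fstIdx = some (!b) := by
  induction w using NormalWord.consRecOn with
  | empty =>
    rw [prod_empty, one_smul]
    exact iff_of_false (aux_fst_of_empty h) (by intro h; cases h)
  | cons i g w hmw hgn hgr hw1 ih =>
    rw [prod_cons, mul_smul]
    have hc : (NormalWord.cons g w hmw hgr).fstIdx = some i := by
      rw [cons_eq_smul]; exact aux_fst_smul g hgr w hmw
    rw [hc]
    by_cases hi : i = b
    · subst hi
      refine iff_of_false ?_ (by simp)
      by_cases hw : w.fstIdx = some (!i)
      · rw [aux_fst_smul g hgr _ (by rw [ih.2 hw]; simp)]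
        simp
      · have hwe : w = NormalWord.empty := by
          refine NormalWord.ext hw1 ?_
          have hn : w.fstIdx = none := by
            cases hh : w.fstIdx with
            | none => rfl
            | some j =>
              rw [hh] at hw hmw
              exfalso
              cases i <;> cases j <;> simp_all
          simpa [CoprodI.Word.fstIdx] using hn
        rw [hwe, prod_empty, one_smul, ← mul_smul, ← map_mul]
        exact aux_fst_of_empty _
    · have hi' : i = !b := by cases i <;> cases b <;> simp_all
      subst hi'
      refine iff_of_true (aux_fst_smul g hgr _ ?_) rfl
      rwa [Ne, ih]
  | base a w hw ih =>
    rw [prod_smul, mul_smul, aux_fst_base, aux_fst_base, ih]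

/-- The ping-pong sets. -/
theorem aux_sets {A : Type*} {G : Bool → Type*} [∀ i, Group (G i)] [Group A]
    {φ : ∀ i, A →* G i} (hφ : ∀ i, Function.Injective (φ i)) (b : Bool) :
    ∃ X : Set (Monoid.PushoutI φ),
      (∀ g, ∀ p ∈ (Monoid.PushoutI.of (φ := φ) b).range, g * p ∈ X ↔ g ∈ X) ∧
      (∀ k : G false, k ∉ (φ false).range → ∀ g ∈ X, Monoid.PushoutI.of false k * g ∉ X) ∧
      (∀ h : G true, h ∉ (φ true).range → ∀ g ∉ X, Monoid.PushoutI.of true h * g ∈ X) := by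
  classical
  obtain ⟨d⟩ := Monoid.PushoutI.NormalWord.transversal_nonempty φ hφ
  let F : Monoid.PushoutI φ → Option Bool :=
    fun g => (g • (Monoid.PushoutI.NormalWord.empty : Monoid.PushoutI.NormalWord d)).fstIdx
  have hF : ∀ i (k : G i), k ∉ (φ i).range → ∀ g, F g ≠ some i →
      F (Monoid.PushoutI.of i k * g) = some i := by
    intro i k hk g hg
    simp only [F, mul_smul]
    exact aux_fst_smul k hk _ hg
  have hI : ∀ g, ∀ p ∈ (Monoid.PushoutI.of (φ := φ) b).range,
      F (g * p) = some (!b) ↔ F g = some (!b) := by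
    rintro g _ ⟨h, rfl⟩
    have := aux_inv (d := d) h (g • Monoid.PushoutI.NormalWord.empty)
    simpa [F, mul_smul] using this
  cases b with
  | true =>
    refine ⟨{g | F g ≠ some false}, ?_, ?_, ?_⟩
    · intro g p hp
      exact not_congr (hI g p hp)
    · intro k hk g hg
      simpa using hF _ k hk g hg
    · intro k hk g hg
      have hg : F g = some false := by simpa using hg
      have := hF _ k hk g (by simp [hg])
      simp [this]
  | false =>
    refine ⟨{g | F g = some true}, hI, ?_, ?_⟩
    · intro k hk g hg
      have hg : F g = some true := by simpa using hg
      have := hF _ k hk g (by simp [hg])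
      simp [this]
    · intro k hk g hg
      exact hF _ k hk g hg

theorem aux_comb {G V : Type*} [Group G] [MulAction G V] (X : Set V) (k h₁ h₂ : G)
    (hk : ∀ v ∈ X, k • v ∉ X) (hh₁ : ∀ v ∉ X, h₁ • v ∈ X) (hh₂ : ∀ v ∉ X, h₂ • v ∈ X)
    (h12 : ∀ v ∉ X, (h₁⁻¹ * h₂) • v ∈ X) :
    ∃ (S : Finset G) (f : V → V), (∀ v, ∃ s ∈ S, v = s • f v) ∧
      ∀ x, ∃ y z, y ≠ z ∧ f y = x ∧ f z = x := by
  classical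
  have hdisj : ∀ u ∉ X, ∀ v ∉ X, h₁ • u ≠ h₂ • v := by
    intro u hu v hv h
    apply hu
    have := h12 v hv
    rwa [mul_smul, ← h, inv_smul_smul] at this
  let σ : V → V := fun v => if v ∈ X then h₁ • k • v else h₂ • v
  have hσX : ∀ v, σ v ∈ X := by
    intro v
    by_cases hv : v ∈ X
    · simpa [σ, hv] using hh₁ _ (hk v hv)
    · simpa [σ, hv] using hh₂ _ hv
  have hσi : ∀ u v, σ u = σ v → u = v := by
    intro u v h
    by_cases hu : u ∈ X <;> by_cases hv : v ∈ X <;> simp only [σ, hu, hv, if_true, if_false] at h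
    · simpa using h
    · exact absurd h (hdisj _ (hk u hu) _ hv)
    · exact absurd h.symm (hdisj _ (hk v hv) _ hu)
    · simpa using h
  let τ₁ : V → V := fun v => h₁ • k • σ v
  let τ₂ : V → V := fun v => h₂ • k • σ v
  have hτ : ∀ u v, τ₁ u ≠ τ₂ v := fun u v => hdisj _ (hk _ (hσX u)) _ (hk _ (hσX v))
  have hτ₁ : ∀ u v, τ₁ u = τ₁ v → u = v := fun u v h => hσi _ _ (by simpa [τ₁] using h)
  have hτ₂ : ∀ u v, τ₂ u = τ₂ v → u = v := fun u v h => hσi _ _ (by simpa [τ₂] using h)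
  let f : V → V := fun v => if h : ∃ u, τ₁ u = v then h.choose else
    if h : ∃ u, τ₂ u = v then h.choose else v
  have hf₁ : ∀ u, f (τ₁ u) = u := by
    intro u
    have h : ∃ u', τ₁ u' = τ₁ u := ⟨u, rfl⟩
    simp only [f, dif_pos h]
    exact hτ₁ _ _ h.choose_spec
  have hf₂ : ∀ u, f (τ₂ u) = u := by
    intro u
    have h' : ¬ ∃ u', τ₁ u' = τ₂ u := fun ⟨u', h⟩ => hτ _ _ h
    have h : ∃ u', τ₂ u' = τ₂ u := ⟨u, rfl⟩
    simp only [f, dif_pos h, dif_neg h']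
    exact hτ₂ _ _ h.choose_spec
  refine ⟨{1, h₁ * k * (h₁ * k), h₁ * k * h₂, h₂ * k * (h₁ * k), h₂ * k * h₂}, f, ?_, ?_⟩
  · intro v
    by_cases h : ∃ u, τ₁ u = v
    · obtain ⟨u, rfl⟩ := h
      rw [hf₁]
      by_cases hu : u ∈ X
      · exact ⟨h₁ * k * (h₁ * k), by simp, by simp [τ₁, σ, hu, mul_smul]⟩
      · exact ⟨h₁ * k * h₂, by simp, by simp [τ₁, σ, hu, mul_smul]⟩
    by_cases h' : ∃ u, τ₂ u = v
    · obtain ⟨u, rfl⟩ := h'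
      rw [hf₂]
      by_cases hu : u ∈ X
      · exact ⟨h₂ * k * (h₁ * k), by simp, by simp [τ₂, σ, hu, mul_smul]⟩
      · exact ⟨h₂ * k * h₂, by simp, by simp [τ₂, σ, hu, mul_smul]⟩
    · exact ⟨1, by simp, by simp only [f, dif_neg h, dif_neg h', one_smul]⟩
  · intro x
    exact ⟨τ₁ x, τ₂ x, hτ _ _, hf₁ x, hf₂ x⟩

theorem aux_word {G α : Type*} [Group G] (η : α → G) (inv : α → α)
    (hsym : IsSymmetricGen η inv) (g : G) : ∃ w : List α, evalWord η w = g := by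
  obtain ⟨-, -, hinv, hcl⟩ := hsym
  have hg : g ∈ Subgroup.closure (Set.range η) := by rw [hcl]; trivial
  have hrev : ∀ w : List α, evalWord η (w.map inv).reverse = (evalWord η w)⁻¹ := by
    intro w
    induction w with
    | nil => simp [evalWord]
    | cons a w ih =>
      simp only [evalWord] at ih ⊢
      simp [hinv] at ih ⊢
      exact ih
  induction hg using Subgroup.closure_induction with
  | mem x hx =>
    obtain ⟨a, rfl⟩ := hx
    exact ⟨[a], by simp [evalWord]⟩
  | one => exact ⟨[], by simp [evalWord]⟩
  | mul x y _ _ hx hy =>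
    obtain ⟨u, rfl⟩ := hx
    obtain ⟨v, rfl⟩ := hy
    exact ⟨u ++ v, by simp [evalWord]⟩
  | inv x _ hx =>
    obtain ⟨u, rfl⟩ := hx
    exact ⟨_, hrev u⟩

theorem aux_main {G α : Type*} [Group G] (P : Subgroup G) (η : α → G) (inv : α → α)
    (hsym : IsSymmetricGen η inv) (X : Set G) (k h₁ h₂ : G)
    (hP : ∀ g, ∀ p ∈ P, g * p ∈ X ↔ g ∈ X)
    (hk : ∀ v ∈ X, k * v ∉ X) (hh₁ : ∀ v ∉ X, h₁ * v ∈ X) (hh₂ : ∀ v ∉ X, h₂ * v ∈ X)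
    (h12 : ∀ v ∉ X, (h₁⁻¹ * h₂) * v ∈ X) :
    ∃ (f : Quotient (QuotientGroup.rightRel P) → Quotient (QuotientGroup.rightRel P))
      (k : ℕ),
      (∀ x, cosetDist P η (f x) x ≤ k) ∧
      (∀ x, ∃ y z, y ≠ z ∧ f y = x ∧ f z = x) := by
  classical
  let Y : Set (G ⧸ P) := {c | ∃ g ∈ X, (g : G ⧸ P) = c}
  have hY : ∀ g : G, (g : G ⧸ P) ∈ Y ↔ g ∈ X := by
    intro g
    constructor
    · rintro ⟨g', hg', h⟩
      rw [QuotientGroup.eq] at h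
      have := hP g' _ h
      rw [mul_inv_cancel_left] at this
      exact this.2 hg'
    · exact fun h => ⟨g, h, rfl⟩
  have hs : ∀ s g : G, s • (g : G ⧸ P) = ((s * g : G) : G ⧸ P) := fun _ _ => rfl
  obtain ⟨S, f, hS, hf⟩ := aux_comb (G := G) Y k h₁ h₂
    (by intro v; induction v using QuotientGroup.induction_on; rw [hs, hY, hY]; exact hk _)
    (by intro v; induction v using QuotientGroup.induction_on; rw [hs, hY, hY]; exact hh₁ _)
    (by intro v; induction v using QuotientGroup.induction_on; rw [hs, hY, hY]; exact hh₂ _)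
    (by intro v; induction v using QuotientGroup.induction_on; rw [hs, hY, hY]; exact h12 _)
  choose W hW using aux_word η inv hsym
  let e := QuotientGroup.quotientRightRelEquivQuotientLeftRel P
  refine ⟨fun x => e.symm (f (e x)), S.sup fun s => (W s⁻¹).length, ?_, ?_⟩
  · intro x
    obtain ⟨s, hsS, h⟩ := hS (e x)
    refine le_trans (Nat.sInf_le ?_) (Finset.le_sup (f := fun s => (W s⁻¹).length) hsS)
    refine ⟨W s⁻¹, rfl, ?_⟩
    obtain ⟨g, hg⟩ := QuotientGroup.mk_surjective (f (e x))
    refine ⟨g⁻¹, ?_, ?_⟩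
    · beta_reduce; rw [← hg]; rfl
    · rw [hW, ← e.symm_apply_apply x, h, ← hg, hs, ← mul_inv_rev]; rfl
  · intro x
    obtain ⟨y, z, hyz, hy, hz⟩ := hf (e x)
    exact ⟨e.symm y, e.symm z, by simpa using hyz, by simp [hy], by simp [hz]⟩

/-- For `G = H ∗_A K` with `[H:A] ≥ 3`, `[K:A] ≥ 2`, `P` the canonical
image of `H` or of `K`, and a finite symmetric generating set `η : Σ → G`, the Schreier
graph of `G` with respect to `P` satisfies the Gromov condition: there are `f : P\G → P\G`
and `k ∈ ℕ` with `d(f(x), x) ≤ k` for all `x` and every fiber of `f` of size at least 2. -/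
theorem stmt_16 {A : Type*} {H K : Type u} [Group A] [Group H] [Group K]
    (φ : A →* H) (ψ : A →* K) (hφ : Function.Injective φ) (hψ : Function.Injective ψ)
    (hH3 : 3 ≤ Cardinal.mk (H ⧸ φ.range))
    (hK2 : 2 ≤ Cardinal.mk (K ⧸ ψ.range))
    (P : Subgroup (AmalgProd φ ψ))
    (hP : P = (amalgH φ ψ).range ∨ P = (amalgK φ ψ).range)
    {α : Type*} [Fintype α] (η : α → AmalgProd φ ψ) (inv : α → α)
    (hsym : IsSymmetricGen η inv) :
    ∃ (f : Quotient (QuotientGroup.rightRel P) → Quotient (QuotientGroup.rightRel P))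
      (k : ℕ),
      (∀ x, cosetDist P η (f x) x ≤ k) ∧
      (∀ x, ∃ y z, y ≠ z ∧ f y = x ∧ f z = x) := by
  have hinj : ∀ i, Function.Injective (amalgMaps φ ψ i) := by
    intro i
    cases i
    · exact hψ
    · exact hφ
  have hPb : ∃ b : Bool, P = (Monoid.PushoutI.of (φ := amalgMaps φ ψ) b).range := by
    rcases hP with h | h
    · exact ⟨true, h⟩
    · exact ⟨false, h⟩
  obtain ⟨b, hb⟩ := hPb
  obtain ⟨X, hX, hXk, hXh⟩ := aux_sets hinj b
  obtain ⟨k, hk⟩ : ∃ k : K, k ∉ ψ.range := by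
    obtain ⟨y, hy⟩ := (Cardinal.two_le_iff' ((1 : K) : K ⧸ ψ.range)).1 hK2
    obtain ⟨k, rfl⟩ := QuotientGroup.mk_surjective y
    rw [Ne, eq_comm, QuotientGroup.eq, inv_one, one_mul] at hy
    exact ⟨k, hy⟩
  obtain ⟨h₁, h₂, hh₁, hh₂, h12⟩ : ∃ h₁ h₂ : H, h₁ ∉ φ.range ∧ h₂ ∉ φ.range ∧
      h₁⁻¹ * h₂ ∉ φ.range := by
    obtain ⟨y, hy, -⟩ := Cardinal.exists_ne_ne_of_three_le hH3
      ((1 : H) : H ⧸ φ.range) ((1 : H) : H ⧸ φ.range)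
    obtain ⟨z, hz, hzy⟩ := Cardinal.exists_ne_ne_of_three_le hH3 ((1 : H) : H ⧸ φ.range) y
    obtain ⟨h₁, rfl⟩ := QuotientGroup.mk_surjective y
    obtain ⟨h₂, rfl⟩ := QuotientGroup.mk_surjective z
    rw [Ne, eq_comm, QuotientGroup.eq, inv_one, one_mul] at hy hz
    rw [Ne, eq_comm, QuotientGroup.eq] at hzy
    exact ⟨h₁, h₂, hy, hz, hzy⟩
  refine aux_main P η inv hsym X (amalgK φ ψ k) (amalgH φ ψ h₁) (amalgH φ ψ h₂)
    (by rw [hb]; exact hX) (hXk k hk) (hXh h₁ hh₁) (hXh h₂ hh₂) ?_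
  rw [← map_inv, ← map_mul]
  exact hXh _ h12
end
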